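/- arXiv:2212.09188 — 9 statements merged into one kernel-verified Lean document; each statement's English description precedes it below -/
import Mathlib

section
/- For every positive integer n and every positive integer p such that 2^{n(n−1)/2} > n! · 2^{n(p−1)}, there exists a tournament T of order n with inv(T) ≥ p; in particular, the number of labelled tournaments on n vertices with inversion number less than p is at most n! · 2^{n(p−1)}. -/
/-- An oriented graph: a digraph with no loops and no pair of opposite arcs. -/
structure OrientedGraph (V : Type*) where
  arc : V → V → Prop
  irrefl' : ∀ v, ¬ arc v v
  asymm' : ∀ u v, arc u v → ¬ arc v u

namespace OrientedGraph

variable {V : Type*}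

/-- An oriented graph is acyclic if it has no directed cycle. -/
def IsAcyclic (D : OrientedGraph V) : Prop := ∀ v, ¬ Relation.TransGen D.arc v v

/-- The result of inverting the sets `X 0, …, X (k-1)` one after another:
an arc is reversed iff an odd number of the sets contain both of its end-vertices. -/
def invert (D : OrientedGraph V) {k : ℕ} (X : Fin k → Set V) : OrientedGraph V where
  arc u v := (Even {i : Fin k | u ∈ X i ∧ v ∈ X i}.ncard ∧ D.arc u v) ∨
    (¬ Even {i : Fin k | u ∈ X i ∧ v ∈ X i}.ncard ∧ D.arc v u)
  irrefl' v h := by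
    rcases h with ⟨_, h⟩ | ⟨_, h⟩ <;> exact D.irrefl' v h
  asymm' u v h1 h2 := by
    have hs : {i : Fin k | v ∈ X i ∧ u ∈ X i} = {i : Fin k | u ∈ X i ∧ v ∈ X i} := by
      ext i; simp only [Set.mem_setOf_eq]; exact and_comm
    rcases h1 with ⟨hE, h1⟩ | ⟨hE, h1⟩ <;> rcases h2 with ⟨hE', h2⟩ | ⟨hE', h2⟩ <;>
      rw [hs] at hE'
    · exact D.asymm' u v h1 h2
    · exact hE' hE
    · exact hE hE'
    · exact D.asymm' v u h1 h2

/-- A family of subsets is decycling if inverting it yields an acyclic oriented graph. -/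
def IsDecycling (D : OrientedGraph V) {k : ℕ} (X : Fin k → Set V) : Prop :=
  (D.invert X).IsAcyclic

/-- The inversion number: the minimum cardinality of a decycling family. -/
noncomputable def inv (D : OrientedGraph V) : ℕ :=
  sInf {k | ∃ X : Fin k → Set V, D.IsDecycling X}

/-- A tournament: an oriented graph whose underlying graph is complete. -/
def IsTournament (D : OrientedGraph V) : Prop :=
  ∀ u v : V, u ≠ v → D.arc u v ∨ D.arc v u

/-- The subdigraph induced by a set of vertices. -/
def induce (D : OrientedGraph V) (S : Set V) : OrientedGraph S where
  arc a b := D.arc a b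
  irrefl' a := D.irrefl' a
  asymm' a b := D.asymm' a b

/-- The dijoin `L ⇒ R`: disjoint union of `L` and `R` plus all arcs from `L` to `R`. -/
def dijoin {α β : Type*} (L : OrientedGraph α) (R : OrientedGraph β) :
    OrientedGraph (α ⊕ β) where
  arc x y :=
    match x, y with
    | Sum.inl a, Sum.inl b => L.arc a b
    | Sum.inl _, Sum.inr _ => True
    | Sum.inr _, Sum.inl _ => False
    | Sum.inr a, Sum.inr b => R.arc a b
  irrefl' x := by
    cases x with
    | inl a => exact L.irrefl' a
    | inr b => exact R.irrefl' b
  asymm' x y := by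
    cases x <;> cases y
    · exact L.asymm' _ _
    · exact fun _ h => h
    · exact fun h _ => h
    · exact R.asymm' _ _

/-- The oriented graph `△(D)`, obtained from `D` by adding two new vertices `u = inr false`
and `v = inr true`, all arcs from `V(D)` to `u`, the arc `u v`, and all arcs from `v`
to `V(D)`. -/
def triangleExt (D : OrientedGraph V) : OrientedGraph (V ⊕ Bool) where
  arc x y :=
    match x, y with
    | Sum.inl a, Sum.inl b => D.arc a b
    | Sum.inl _, Sum.inr w => w = false
    | Sum.inr w, Sum.inl _ => w = true
    | Sum.inr w, Sum.inr w' => w = false ∧ w' = true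
  irrefl' x := by
    cases x with
    | inl a => exact D.irrefl' a
    | inr w => exact fun h => absurd (h.1.symm.trans h.2) (by decide)
  asymm' x y := by
    cases x <;> cases y <;> intro h1 h2
    · exact D.asymm' _ _ h1 h2
    · exact absurd (h1.symm.trans h2) (by decide)
    · exact absurd (h2.symm.trans h1) (by decide)
    · exact absurd (h1.2.symm.trans h2.1) (by decide)

end OrientedGraph

/-- `maxInv n` is the maximum of the inversion numbers of tournaments of order `n`. -/
noncomputable def maxInv (n : ℕ) : ℕ :=
  sSup {m | ∃ T : OrientedGraph (Fin n), T.IsTournament ∧ T.inv = m}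

namespace OrientedGraph

lemma ext_arc {V : Type*} {D E : OrientedGraph V} (h : ∀ u v, D.arc u v ↔ E.arc u v) :
    D = E := by
  cases D; cases E
  congr
  funext u v
  exact propext (h u v)

lemma count_symm {V : Type*} {k : ℕ} (X : Fin k → Set V) (u v : V) :
    {i : Fin k | v ∈ X i ∧ u ∈ X i} = {i : Fin k | u ∈ X i ∧ v ∈ X i} := by
  ext i; simp only [Set.mem_setOf_eq]; exact and_comm

lemma invert_invert {V : Type*} (D : OrientedGraph V) {k : ℕ} (X : Fin k → Set V) :
    (D.invert X).invert X = D := by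
  apply ext_arc
  intro u v
  simp only [invert]
  rw [count_symm X u v]
  tauto

lemma invert_isTournament {V : Type*} {D : OrientedGraph V} (hD : D.IsTournament) {k : ℕ}
    (X : Fin k → Set V) : (D.invert X).IsTournament := by
  intro u v huv
  have := hD u v huv
  simp only [invert]
  rw [count_symm X u v]
  tauto

/-- The transitive tournament given by a permutation. -/
def ofPerm {n : ℕ} (σ : Equiv.Perm (Fin n)) : OrientedGraph (Fin n) where
  arc u v := σ u < σ v
  irrefl' v := lt_irrefl _
  asymm' u v h := not_lt_of_gt h

lemma exists_perm {n : ℕ} {D : OrientedGraph (Fin n)} (hD : D.IsTournament)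
    (hA : D.IsAcyclic) : ∃ σ : Equiv.Perm (Fin n), D = ofPerm σ := by
  classical
  have htr : ∀ u v w, D.arc u v → D.arc v w → D.arc u w := by
    intro u v w h1 h2
    have hne : u ≠ w := by
      rintro rfl
      exact D.asymm' _ _ h1 h2
    rcases hD u w hne with h | h
    · exact h
    · exact absurd (((Relation.TransGen.single h1).tail h2).tail h) (hA u)
  let r : Fin n → Fin n := fun u =>
    ⟨(Finset.univ.filter (fun w => D.arc w u)).card, by
      have : (Finset.univ.filter (fun w => D.arc w u)) ⊂ Finset.univ := by
        rw [Finset.ssubset_univ_iff]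
        intro h
        have := Finset.mem_univ u
        rw [← h] at this
        exact D.irrefl' u (by simpa using this)
      simpa using Finset.card_lt_card this⟩
  have hmono : ∀ u v, D.arc u v → r u < r v := by
    intro u v h
    change (Finset.univ.filter (fun w => D.arc w u)).card <
      (Finset.univ.filter (fun w => D.arc w v)).card
    apply Finset.card_lt_card
    rw [Finset.ssubset_iff_of_subset]
    · exact ⟨u, by simpa using h, by simpa using D.irrefl' u⟩
    · intro w hw
      simp only [Finset.mem_filter, Finset.mem_univ, true_and] at hw ⊢
      exact htr _ _ _ hw h
  have hinj : Function.Injective r := by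
    intro u v huv
    by_contra hne
    rcases hD u v hne with h | h
    · exact (hmono _ _ h).ne huv
    · exact (hmono _ _ h).ne huv.symm
  refine ⟨Equiv.ofBijective r (Finite.injective_iff_bijective.mp hinj), ext_arc ?_⟩
  intro u v
  refine ⟨hmono u v, fun h => ?_⟩
  have h' : r u < r v := h
  have hne : u ≠ v := by
    rintro rfl
    exact lt_irrefl _ h'
  rcases hD u v hne with h1 | h1
  · exact h1
  · exact absurd (hmono _ _ h1) (not_lt_of_gt h')

lemma exists_decycling {n : ℕ} {T : OrientedGraph (Fin n)} (hT : T.IsTournament) :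
    ∃ k, ∃ X : Fin k → Set (Fin n), T.IsDecycling X := by
  classical
  let e := Fintype.equivFin {q : Fin n × Fin n // q.1 < q.2 ∧ T.arc q.2 q.1}
  refine ⟨_, fun i => {(e.symm i).1.1, (e.symm i).1.2}, ?_⟩
  set X : Fin _ → Set (Fin n) := fun i => {(e.symm i).1.1, (e.symm i).1.2} with hX
  have key : ∀ u v, v < u → ∀ i, (u ∈ X i ∧ v ∈ X i) → (e.symm i).1 = (v, u) := by
    intro u v hvu i hi
    have hlt := (e.symm i).2.1
    simp only [hX, Set.mem_insert_iff, Set.mem_singleton_iff] at hi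
    obtain ⟨h1, h2⟩ := hi
    rcases h1 with h1 | h1 <;> rcases h2 with h2 | h2
    · omega
    · rw [← h1, ← h2] at hlt
      omega
    · rw [h1, h2]
    · omega
  have hlt : ∀ u v, (T.invert X).arc u v → u < v := by
    intro u v h
    by_contra hnot
    have hne : u ≠ v := by
      rintro rfl
      exact (T.invert X).irrefl' _ h
    have hvu : v < u := lt_of_le_of_ne (not_lt.mp hnot) hne.symm
    rcases hT u v hne with h1 | h1
    · have hc : {i | u ∈ X i ∧ v ∈ X i} = {e ⟨(v, u), hvu, h1⟩} := by
        ext i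
        simp only [Set.mem_setOf_eq, Set.mem_singleton_iff]
        constructor
        · intro hi
          rw [← Equiv.symm_apply_eq]
          exact Subtype.ext (key u v hvu i hi)
        · rintro rfl
          simp [hX]
      simp only [invert, hc, Set.ncard_singleton] at h
      rcases h with h | h
      · exact absurd h.1 (by decide)
      · exact T.asymm' _ _ h1 h.2
    · have hc : {i | u ∈ X i ∧ v ∈ X i} = ∅ := by
        ext i
        simp only [Set.mem_setOf_eq, Set.mem_empty_iff_false, iff_false]
        intro hi
        have h2 := (e.symm i).2.2
        rw [key u v hvu i hi] at h2
        exact T.asymm' _ _ h1 h2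
      simp only [invert, hc, Set.ncard_empty] at h
      rcases h with h | h
      · exact T.asymm' _ _ h1 h.2
      · exact h.1 (by decide)
  intro v hv
  have hv' : Relation.TransGen (fun a b : Fin n => a < b) v v :=
    Relation.TransGen.mono hlt _ _ hv
  have : ∀ a b : Fin n, Relation.TransGen (fun a b : Fin n => a < b) a b → a < b := by
    intro a b hab
    induction hab with
    | single h => exact h
    | tail _ h ih => exact ih.trans h
  exact lt_irrefl _ (this _ _ hv')

lemma exists_pad {V : Type*} (D : OrientedGraph V) {k m : ℕ} (hkm : k ≤ m)
    (X : Fin k → Set V) : ∃ Y : Fin m → Set V, D.invert Y = D.invert X := by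
  refine ⟨fun i => if h : i.1 < k then X ⟨i.1, h⟩ else ∅, ext_arc ?_⟩
  intro u v
  have : {i : Fin m | u ∈ (if h : i.1 < k then X ⟨i.1, h⟩ else ∅) ∧
      v ∈ (if h : i.1 < k then X ⟨i.1, h⟩ else ∅)}
      = Fin.castLE hkm '' {i : Fin k | u ∈ X i ∧ v ∈ X i} := by
    ext i
    simp only [Set.mem_setOf_eq, Set.mem_image]
    constructor
    · intro h
      by_cases hi : i.1 < k
      · simp only [hi, dif_pos] at h
        exact ⟨⟨i.1, hi⟩, h, rfl⟩
      · simp [hi] at h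
    · rintro ⟨j, hj, rfl⟩
      simpa using hj
  simp only [invert]
  rw [this, Set.ncard_image_of_injective _ (Fin.castLE_injective hkm)]

/-- The tournament coded by a set of non-diagonal pairs. -/
def ofSet {n : ℕ} (s : Set {a : Sym2 (Fin n) // ¬ a.IsDiag}) : OrientedGraph (Fin n) where
  arc u v := u ≠ v ∧ (u < v ↔ s(u, v) ∈ Subtype.val '' s)
  irrefl' v h := h.1 rfl
  asymm' u v h1 h2 := by
    have h3 := h1.2
    have h4 := h2.2
    rw [Sym2.eq_swap] at h4
    have := h1.1
    rw [← h4] at h3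
    rcases lt_or_gt_of_ne this with h | h
    · exact not_lt_of_gt h (h3.mp h)
    · exact not_lt_of_gt h (h3.mpr h)

lemma ofSet_isTournament {n : ℕ} (s : Set {a : Sym2 (Fin n) // ¬ a.IsDiag}) :
    (ofSet s).IsTournament := by
  intro u v huv
  simp only [ofSet]
  rw [Sym2.eq_swap (a := v) (b := u)]
  have h1 : v < u ↔ ¬ u < v := by
    constructor
    · exact fun h => not_lt_of_gt h
    · exact fun h => lt_of_le_of_ne (not_lt.mp h) huv.symm
  have := huv.symm
  rw [h1]
  tauto

lemma ofSet_injective {n : ℕ} : Function.Injective (ofSet (n := n)) := by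
  intro s t hst
  ext ⟨a, ha⟩
  induction a using Sym2.ind with
  | _ u v =>
    have huv : u ≠ v := by simpa using ha
    have h : (ofSet s).arc u v ↔ (ofSet t).arc u v := by rw [hst]
    have hs : ∀ r : Set {a : Sym2 (Fin n) // ¬ a.IsDiag},
        s(u, v) ∈ Subtype.val '' r ↔ (⟨s(u, v), ha⟩ : {a : Sym2 (Fin n) // ¬ a.IsDiag}) ∈ r := by
      intro r
      constructor
      · rintro ⟨b, hb, hbe⟩
        have : b = ⟨s(u, v), ha⟩ := Subtype.ext hbe
        rwa [← this]
      · exact fun hr => ⟨_, hr, rfl⟩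
    simp only [ofSet, hs] at h
    tauto

instance finiteOriented (n : ℕ) : Finite (OrientedGraph (Fin n)) :=
  Finite.of_injective (fun D : OrientedGraph (Fin n) => D.arc) (by
    intro D E h
    exact ext_arc (fun u v => by
      have : D.arc = E.arc := h
      rw [this]))

end OrientedGraph

open OrientedGraph in
theorem exists_tournament_large_inv (n p : ℕ) (hn : 1 ≤ n) (hp : 1 ≤ p)
    (h : n.factorial * 2 ^ (n * (p - 1)) < 2 ^ (n * (n - 1) / 2)) :
    (∃ T : OrientedGraph (Fin n), T.IsTournament ∧ p ≤ T.inv) ∧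
      {T : OrientedGraph (Fin n) | T.IsTournament ∧ T.inv < p}.ncard ≤
        n.factorial * 2 ^ (n * (p - 1)) := by
  classical
  have hcount : {T : OrientedGraph (Fin n) | T.IsTournament ∧ T.inv < p}.ncard ≤
        n.factorial * 2 ^ (n * (p - 1)) := by
    let F : Equiv.Perm (Fin n) × (Fin (p - 1) → Set (Fin n)) → OrientedGraph (Fin n) :=
      fun q => (ofPerm q.1).invert q.2
    have hsub : {T : OrientedGraph (Fin n) | T.IsTournament ∧ T.inv < p} ⊆
        F '' Set.univ := by
      rintro T ⟨hT, hinv⟩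
      obtain ⟨X, hX⟩ : ∃ X : Fin T.inv → Set (Fin n), T.IsDecycling X :=
        Nat.sInf_mem (exists_decycling hT)
      obtain ⟨Y, hY⟩ := exists_pad T (show T.inv ≤ p - 1 by omega) X
      have hA : (T.invert Y).IsAcyclic := by rw [hY]; exact hX
      obtain ⟨σ, hσ⟩ := exists_perm (invert_isTournament hT Y) hA
      refine ⟨(σ, Y), Set.mem_univ _, ?_⟩
      change (ofPerm σ).invert Y = T
      rw [← hσ, invert_invert]
    refine (Set.ncard_le_ncard hsub (Set.toFinite _)).trans
      ((Set.ncard_image_le (Set.toFinite _)).trans ?_)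
    rw [Set.ncard_univ, Nat.card_eq_fintype_card, Fintype.card_prod, Fintype.card_perm,
      Fintype.card_fun, Fintype.card_set, Fintype.card_fin, Fintype.card_fin, ← pow_mul]
  refine ⟨?_, hcount⟩
  by_contra hcon
  push Not at hcon
  have hsub : Set.range (ofSet (n := n)) ⊆
      {T : OrientedGraph (Fin n) | T.IsTournament ∧ T.inv < p} := by
    rintro _ ⟨s, rfl⟩
    exact ⟨ofSet_isTournament s, hcon _ (ofSet_isTournament s)⟩
  have h1 := Set.ncard_le_ncard hsub (Set.toFinite _)
  rw [← Set.image_univ, Set.ncard_image_of_injective _ ofSet_injective, Set.ncard_univ,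
    Nat.card_eq_fintype_card, Fintype.card_set, Sym2.card_subtype_not_diag, Fintype.card_fin,
    Nat.choose_two_right] at h1
  omega
end

section
/- Let n ≥ 1 be an integer, let x₁,…,x_n ∈ 𝔽₂, and let r ∈ {0,…,n}. Among the 2^{n(n−1)/2} symmetric n×n matrices over 𝔽₂ whose diagonal entries are x₁,…,x_n, the number of matrices M with rank(M) ≤ n − r (rank over 𝔽₂) is at most 2^{n(n−1)/2} · 2^{−(r²−4r)/2}. Equivalently, if M is chosen uniformly at random among these matrices, then Pr[rank(M) ≤ n − r] ≤ 2^{−(r²−4r)/2}. -/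
open Finset in
/-- symmetric matrices with prescribed diagonal and corank at least `k` -/
noncomputable def symLow (n : ℕ) (x : Fin n → ZMod 2) (k : ℕ) :
    Finset (Matrix (Fin n) (Fin n) (ZMod 2)) :=
  haveI := Classical.decPred (fun M : Matrix (Fin n) (Fin n) (ZMod 2) =>
    M.IsSymm ∧ (∀ i, M i i = x i) ∧ M.rank + k ≤ n)
  Finset.univ.filter (fun M : Matrix (Fin n) (Fin n) (ZMod 2) =>
    M.IsSymm ∧ (∀ i, M i i = x i) ∧ M.rank + k ≤ n)

lemma mem_symLow {n : ℕ} {x : Fin n → ZMod 2} {k : ℕ} {M : Matrix (Fin n) (Fin n) (ZMod 2)} :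
    M ∈ symLow n x k ↔ M.IsSymm ∧ (∀ i, M i i = x i) ∧ M.rank + k ≤ n := by
  simp [symLow]

lemma range_sub_le {m n : ℕ} (B : Matrix (Fin m) (Fin (n+1)) (ZMod 2)) :
    LinearMap.range (B.submatrix id Fin.succ).mulVecLin ≤ LinearMap.range B.mulVecLin := by
  rintro _ ⟨w, rfl⟩
  refine ⟨Fin.cons 0 w, ?_⟩
  ext i
  simp [Matrix.mulVec, dotProduct, Fin.sum_univ_succ]

lemma rank_sub_le {m n : ℕ} (B : Matrix (Fin m) (Fin (n+1)) (ZMod 2)) :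
    (B.submatrix id Fin.succ).rank ≤ B.rank :=
  Submodule.finrank_mono (range_sub_le B)

lemma rank_sub_lt {m n : ℕ} (B : Matrix (Fin m) (Fin (n+1)) (ZMod 2))
    (h : (fun i => B i 0) ∉ LinearMap.range (B.submatrix id Fin.succ).mulVecLin) :
    (B.submatrix id Fin.succ).rank + 1 ≤ B.rank := by
  apply Submodule.finrank_lt_finrank_of_lt
  refine lt_of_le_of_ne (range_sub_le B) ?_
  intro he
  apply h
  rw [he]
  refine ⟨Pi.single 0 1, ?_⟩
  ext i
  simp

lemma rank_step {n : ℕ} (M : Matrix (Fin (n+1)) (Fin (n+1)) (ZMod 2)) (hM : M.IsSymm) :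
    (M.submatrix id Fin.succ).rank = (M.submatrix Fin.succ id).rank := by
  rw [← Matrix.rank_transpose, Matrix.transpose_submatrix, hM.eq]

lemma rank_border_le {n : ℕ} (M : Matrix (Fin (n+1)) (Fin (n+1)) (ZMod 2)) (hM : M.IsSymm) :
    (M.submatrix Fin.succ Fin.succ).rank ≤ M.rank := by
  have h1 := rank_sub_le M
  have h2 := rank_sub_le (M.submatrix Fin.succ id)
  rw [rank_step M hM] at h1
  simp only [Matrix.submatrix_submatrix, Function.comp_id, Function.id_comp] at h2
  exact h2.trans h1

lemma rank_border_lt {n : ℕ} (M : Matrix (Fin (n+1)) (Fin (n+1)) (ZMod 2)) (hM : M.IsSymm)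
    (h : (fun i : Fin n => M 0 i.succ) ∉
      LinearMap.range (M.submatrix Fin.succ Fin.succ).mulVecLin) :
    (M.submatrix Fin.succ Fin.succ).rank + 2 ≤ M.rank := by
  have hs : ∀ i : Fin n, M i.succ 0 = M 0 i.succ := fun i => hM.apply _ _
  have h1 := rank_sub_lt M (by
    rintro ⟨w, hw⟩
    apply h
    refine ⟨w, ?_⟩
    ext i
    have := congrFun hw i.succ
    simpa [Matrix.mulVec, dotProduct, hs] using this)
  have h2 := rank_sub_lt (M.submatrix Fin.succ id) (by
    simpa [Matrix.submatrix_submatrix, hs] using h)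
  rw [rank_step M hM] at h1
  simp only [Matrix.submatrix_submatrix, Function.comp_id, Function.id_comp] at h2
  omega

lemma border_inj {n : ℕ} (x : Fin (n+1) → ZMod 2)
    (M N : Matrix (Fin (n+1)) (Fin (n+1)) (ZMod 2))
    (hM : M.IsSymm) (hN : N.IsSymm) (hMx : ∀ i, M i i = x i) (hNx : ∀ i, N i i = x i)
    (h1 : M.submatrix Fin.succ Fin.succ = N.submatrix Fin.succ Fin.succ)
    (h2 : (fun i : Fin n => M 0 i.succ) = fun i : Fin n => N 0 i.succ) : M = N := by
  ext i j
  refine Fin.cases ?_ (fun i => ?_) i <;> refine Fin.cases ?_ (fun j => ?_) j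
  · rw [hMx, hNx]
  · exact congrFun h2 j
  · rw [← hM.apply, ← hN.apply]; exact congrFun h2 i
  · exact congrFun (congrFun h1 i) j

lemma card_total_step (n : ℕ) (x : Fin (n+1) → ZMod 2) :
    (symLow (n+1) x 0).card ≤ (symLow n (fun i => x i.succ) 0).card * 2 ^ n := by
  have : (symLow n (fun i => x i.succ) 0 ×ˢ (Finset.univ : Finset (Fin n → ZMod 2))).card
      = (symLow n (fun i => x i.succ) 0).card * 2 ^ n := by
    simp [Finset.card_product, ZMod.card]
  rw [← this]
  refine Finset.card_le_card_of_injOn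
    (fun M => (M.submatrix Fin.succ Fin.succ, fun i : Fin n => M 0 i.succ)) ?_ ?_
  · intro M hM
    have hM := mem_symLow.1 hM
    simp only [Finset.coe_product, Set.mem_prod, Finset.mem_coe, Finset.mem_univ, and_true]
    refine mem_symLow.2 ⟨hM.1.submatrix _, fun i => hM.2.1 _, ?_⟩
    simpa using Matrix.rank_le_width (M.submatrix Fin.succ Fin.succ)
  · intro M hM N hN h
    have hM := mem_symLow.1 hM
    have hN := mem_symLow.1 hN
    simp only [Prod.mk.injEq] at h
    exact border_inj x M N hM.1 hN.1 hM.2.1 hN.2.1 h.1 h.2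

lemma card_step (n k : ℕ) (x : Fin (n+1) → ZMod 2) :
    (symLow (n+1) x (k+1)).card * 2 ^ k ≤ (symLow n (fun i => x i.succ) (k+2)).card * 2 ^ n * 2 ^ k
      + (symLow n (fun i => x i.succ) k).card * 2 ^ n := by
  classical
  set A := symLow n (fun i => x i.succ) (k+2)
  set B := symLow n (fun i => x i.succ) k with hB
  let C : Matrix (Fin n) (Fin n) (ZMod 2) → Finset (Fin n → ZMod 2) :=
    fun M => Finset.univ.filter (fun v => v ∈ LinearMap.range M.mulVecLin)
  have hC : ∀ M ∈ B, (C M).card * 2 ^ k ≤ 2 ^ n := by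
    intro M hM
    have hM := (mem_symLow.1 hM).2.2
    have : (C M).card = 2 ^ M.rank := by
      have h := Module.card_eq_pow_finrank (K := ZMod 2) (V := LinearMap.range M.mulVecLin)
      rw [ZMod.card] at h
      rw [Matrix.rank, ← h, Fintype.card_subtype]
    rw [this, ← pow_add]
    exact Nat.pow_le_pow_right (by norm_num) hM
  have key : (symLow (n+1) x (k+1)).card ≤ A.card * 2 ^ n + ∑ M ∈ B, (C M).card := by
    have h1 : (A.sigma (fun _ => (Finset.univ : Finset (Fin n → ZMod 2)))).card
        = A.card * 2 ^ n := by
      simp [Finset.card_sigma, ZMod.card]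
    rw [← h1, ← Finset.card_sigma]
    refine le_trans ?_ (Finset.card_union_le _ _)
    refine Finset.card_le_card_of_injOn
      (fun M => ⟨M.submatrix Fin.succ Fin.succ, fun i : Fin n => M 0 i.succ⟩) ?_ ?_
    · intro M hM
      have hM := mem_symLow.1 hM
      have hle := rank_border_le M hM.1
      rw [Finset.mem_coe, Finset.mem_union, Finset.mem_sigma, Finset.mem_sigma]
      by_cases h : (fun i : Fin n => M 0 i.succ) ∈
          LinearMap.range (M.submatrix Fin.succ Fin.succ).mulVecLin
      · right
        refine ⟨mem_symLow.2 ⟨hM.1.submatrix _, fun i => hM.2.1 _, ?_⟩, ?_⟩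
        · have := hM.2.2
          dsimp only
          omega
        · simp only [C, Finset.mem_filter, Finset.mem_univ, true_and]
          exact h
      · left
        have hlt := rank_border_lt M hM.1 h
        refine ⟨mem_symLow.2 ⟨hM.1.submatrix _, fun i => hM.2.1 _, ?_⟩, Finset.mem_univ _⟩
        have := hM.2.2
        dsimp only
        omega
    · intro M hM N hN h
      have hM := mem_symLow.1 hM
      have hN := mem_symLow.1 hN
      simp only [Sigma.mk.injEq, heq_eq_eq] at h
      exact border_inj x M N hM.1 hN.1 hM.2.1 hN.2.1 h.1 h.2
  have h3 : (∑ M ∈ B, (C M).card) * 2 ^ k ≤ B.card * 2 ^ n := by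
    rw [Finset.sum_mul, ← smul_eq_mul (a := B.card)]
    exact Finset.sum_le_card_nsmul _ _ _ hC
  calc _ ≤ (A.card * 2 ^ n + ∑ M ∈ B, (C M).card) * 2 ^ k := Nat.mul_le_mul_right _ key
    _ = A.card * 2 ^ n * 2 ^ k + (∑ M ∈ B, (C M).card) * 2 ^ k := by ring
    _ ≤ _ := by gcongr

lemma tri_succ (n : ℕ) : (n + 1) * (n + 1 - 1) / 2 = n * (n - 1) / 2 + n := by
  simp only [← Finset.sum_range_id, ← Finset.sum_range_id n,
    Finset.sum_range_succ]

lemma card_total (n : ℕ) (x : Fin n → ZMod 2) :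
    (symLow n x 0).card ≤ 2 ^ (n * (n - 1) / 2) := by
  induction n with
  | zero => exact Finset.card_le_one.2 (fun a _ b _ => Subsingleton.elim a b)
  | succ n ih =>
    rw [tri_succ, pow_add]
    exact (card_total_step n x).trans (Nat.mul_le_mul_right _ (ih _))

lemma symLow_anti (n k : ℕ) (x : Fin n → ZMod 2) : (symLow n x k).card ≤ (symLow n x 0).card := by
  apply Finset.card_le_card
  intro M hM
  have hM := mem_symLow.1 hM
  exact mem_symLow.2 ⟨hM.1, hM.2.1, by omega⟩

/-- the bound -/
noncomputable def bnd (k : ℕ) : ℝ := (2 : ℝ) ^ (-(((k : ℝ) ^ 2 - 4 * (k : ℝ)) / 2))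

lemma bnd_pos (k : ℕ) : 0 < bnd k := Real.rpow_pos_of_pos (by norm_num) _

lemma bnd_ge_one {k : ℕ} (hk : k ≤ 4) : 1 ≤ bnd k := by
  apply Real.one_le_rpow (by norm_num)
  have : (k : ℝ) ≤ 4 := by exact_mod_cast hk
  have h0 : (0 : ℝ) ≤ k := by positivity
  nlinarith

lemma bnd_up {k : ℕ} (hk : 4 ≤ k) : bnd (k+2) ≤ bnd (k+1) * (1/4) := by
  have : (1/4 : ℝ) = 2 ^ (-2 : ℝ) := by
    rw [Real.rpow_neg (by norm_num)]; norm_num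
  rw [this, bnd, bnd, ← Real.rpow_add (by norm_num)]
  apply Real.rpow_le_rpow_of_exponent_le (by norm_num)
  have : (4 : ℝ) ≤ k := by exact_mod_cast hk
  push_cast
  nlinarith

lemma bnd_down (k : ℕ) : bnd k ≤ bnd (k+1) * 2 ^ k * (1/2) := by
  have : (1/2 : ℝ) = 2 ^ (-1 : ℝ) := by
    rw [Real.rpow_neg (by norm_num)]; norm_num
  rw [this, bnd, bnd, ← Real.rpow_natCast 2 k, ← Real.rpow_add (by norm_num),
    ← Real.rpow_add (by norm_num)]
  apply Real.rpow_le_rpow_of_exponent_le (by norm_num)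
  push_cast
  nlinarith

lemma main_bound (n : ℕ) : ∀ (x : Fin n → ZMod 2) (k : ℕ),
    ((symLow n x k).card : ℝ) ≤ 2 ^ (n * (n - 1) / 2) * bnd k := by
  have small : ∀ (n : ℕ) (x : Fin n → ZMod 2) (k : ℕ), k ≤ 4 →
      ((symLow n x k).card : ℝ) ≤ 2 ^ (n * (n - 1) / 2) * bnd k := by
    intro n x k hk
    have h1 : ((symLow n x k).card : ℝ) ≤ 2 ^ (n * (n - 1) / 2) := by
      exact_mod_cast (symLow_anti n k x).trans (card_total n x)
    exact h1.trans (le_mul_of_one_le_right (by positivity) (bnd_ge_one hk))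
  induction n with
  | zero =>
    intro x k
    by_cases hk : k ≤ 4
    · exact small _ x k hk
    · have : symLow 0 x k = ∅ := by
        apply Finset.eq_empty_of_forall_notMem
        intro M hM
        have := (mem_symLow.1 hM).2.2
        omega
      rw [this]
      have := bnd_pos k
      simp only [Finset.card_empty, Nat.cast_zero]
      positivity
  | succ n ih =>
    intro x k
    by_cases hk : k ≤ 4
    · exact small _ x k hk
    · obtain ⟨k, rfl⟩ : ∃ j, k = j + 1 := ⟨k - 1, by omega⟩
      have hs : ((symLow (n+1) x (k+1)).card : ℝ) * 2 ^ k ≤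
          (symLow n (fun i => x i.succ) (k+2)).card * 2 ^ n * 2 ^ k
            + (symLow n (fun i => x i.succ) k).card * 2 ^ n := by
        exact_mod_cast card_step n k x
      have i1 := ih (fun i => x i.succ) (k+2)
      have i2 := ih (fun i => x i.succ) k
      have b1 := bnd_up (k := k) (by omega)
      have b2 := bnd_down k
      have hb := bnd_pos (k+1)
      rw [tri_succ, pow_add]
      set T : ℝ := 2 ^ (n * (n - 1) / 2)
      have hT : 0 < T := by positivity
      have hk0 : (0:ℝ) < 2 ^ k := by positivity
      refine le_of_mul_le_mul_right (hs.trans ?_) hk0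
      calc _ ≤ T * (bnd (k+1) * (1/4)) * 2 ^ n * 2 ^ k
            + T * (bnd (k+1) * 2 ^ k * (1/2)) * 2 ^ n := by
            gcongr
            · exact i1.trans (by gcongr)
            · exact i2.trans (by gcongr)
        _ = (3/4) * (T * 2 ^ n * bnd (k+1) * 2 ^ k) := by ring
        _ ≤ _ := by
            have : 0 < T * 2 ^ n * bnd (k+1) * 2 ^ k := by positivity
            linarith

/-- among the `2^{n(n-1)/2}` symmetric `n × n` matrices over `𝔽₂` with
prescribed diagonal entries `x₁, …, xₙ`, the number of those of rank at most `n - r`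
is at most `2^{n(n-1)/2} · 2^{-(r² - 4r)/2}`. -/
theorem count_low_rank_symmetric_matrices (n : ℕ) (hn : 1 ≤ n) (x : Fin n → ZMod 2)
    (r : ℕ) (hr : r ≤ n) :
    ({M : Matrix (Fin n) (Fin n) (ZMod 2) |
        M.IsSymm ∧ (∀ i, M i i = x i) ∧ M.rank ≤ n - r}.ncard : ℝ) ≤
      (2 : ℝ) ^ (n * (n - 1) / 2) * (2 : ℝ) ^ (-(((r : ℝ) ^ 2 - 4 * (r : ℝ)) / 2)) := by
  have h : {M : Matrix (Fin n) (Fin n) (ZMod 2) |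
        M.IsSymm ∧ (∀ i, M i i = x i) ∧ M.rank ≤ n - r} = (symLow n x r : Set _) := by
    ext M
    rw [Finset.mem_coe, mem_symLow, Set.mem_ofPred_eq, Nat.le_sub_iff_add_le hr]
  rw [h, Set.ncard_coe_finset]
  exact main_bound n x r
end

section
/- Let A be a symmetric n×n matrix over 𝔽₂ with rank(A) = n − r for some r ≥ 1, let d ∈ 𝔽₂, and let B be a symmetric (n+1)×(n+1) matrix over 𝔽₂ whose leading principal n×n submatrix is A and whose (n+1,n+1) entry is d. Let v ∈ 𝔽₂ⁿ be the vector formed by the first n entries of the last row of B. If v lies in the row space of A, then rank(B) ≤ rank(A) + 1; otherwise, rank(B) = rank(A) + 2. In particular, among the 2ⁿ such extensions B of A, exactly 2^{n−r} satisfy rank(B) ≤ rank(A) + 1 and the remaining 2ⁿ − 2^{n−r} satisfy rank(B) = rank(A) + 2. -/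
theorem span_rows_snoc {m k : ℕ} (M : Matrix (Fin (m + 1)) (Fin k) (ZMod 2)) :
    Submodule.span (ZMod 2) (Set.range M.row) =
      Submodule.span (ZMod 2) (Set.range fun i : Fin m => M i.castSucc) ⊔
        Submodule.span (ZMod 2) {M (Fin.last m)} := by
  rw [← Submodule.span_union]
  congr 1
  ext x
  constructor
  · rintro ⟨i, rfl⟩
    induction i using Fin.lastCases with
    | last => right; rfl
    | cast i => left; exact ⟨i, rfl⟩
  · rintro (⟨i, rfl⟩ | h)
    · exact ⟨i.castSucc, rfl⟩
    · exact ⟨Fin.last m, h.symm⟩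

theorem rank_snoc_mem {m k : ℕ} (M : Matrix (Fin (m + 1)) (Fin k) (ZMod 2))
    (h : M (Fin.last m) ∈
      Submodule.span (ZMod 2) (Set.range fun i : Fin m => M i.castSucc)) :
    M.rank = (M.submatrix Fin.castSucc id).rank := by
  rw [Matrix.rank_eq_finrank_span_row, Matrix.rank_eq_finrank_span_row, span_rows_snoc,
    sup_eq_left.2 ((Submodule.span_singleton_le_iff_mem _ _).2 h)]
  rfl

theorem rank_snoc_not_mem {m k : ℕ} (M : Matrix (Fin (m + 1)) (Fin k) (ZMod 2))
    (h : M (Fin.last m) ∉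
      Submodule.span (ZMod 2) (Set.range fun i : Fin m => M i.castSucc)) :
    M.rank = (M.submatrix Fin.castSucc id).rank + 1 := by
  rw [Matrix.rank_eq_finrank_span_row, Matrix.rank_eq_finrank_span_row, span_rows_snoc,
    Submodule.finrank_sup_span_singleton h]
  rfl

theorem rank_ext_aux {n : ℕ} (A : Matrix (Fin n) (Fin n) (ZMod 2))
    (B : Matrix (Fin (n + 1)) (Fin (n + 1)) (ZMod 2)) (hB : B.IsSymm)
    (hBA : ∀ i j : Fin n, B i.castSucc j.castSucc = A i j) :
    ((fun i : Fin n => B (Fin.last n) i.castSucc) ∈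
          Submodule.span (ZMod 2) (Set.range fun i : Fin n => A i) →
        B.rank ≤ A.rank + 1) ∧
       ((fun i : Fin n => B (Fin.last n) i.castSucc) ∉
          Submodule.span (ZMod 2) (Set.range fun i : Fin n => A i) →
        B.rank = A.rank + 2) := by
  set C : Matrix (Fin (n + 1)) (Fin n) (ZMod 2) := B.submatrix id Fin.castSucc with hC
  have hCA : C.submatrix Fin.castSucc id = A := by
    ext i j; exact hBA i j
  have hrows : (fun i : Fin n => C i.castSucc) = fun i : Fin n => A i := by
    funext i j; exact hBA i j
  have hBC : (B.submatrix Fin.castSucc id).rank = C.rank := by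
    rw [← Matrix.rank_transpose C]
    congr 1
    ext i j
    exact hB.apply _ _
  constructor
  · intro h
    have h1 : C.rank = A.rank := by
      rw [← hCA]
      exact rank_snoc_mem C (by rw [hrows]; exact h)
    rw [← h1, ← hBC]
    by_cases h2 : B (Fin.last n) ∈
      Submodule.span (ZMod 2) (Set.range fun i : Fin n => B i.castSucc)
    · rw [rank_snoc_mem B h2]; omega
    · rw [rank_snoc_not_mem B h2]
  · intro h
    have h1 : C.rank = A.rank + 1 := by
      rw [← hCA]
      exact rank_snoc_not_mem C (by rw [hrows]; exact h)
    have h2 : B (Fin.last n) ∉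
        Submodule.span (ZMod 2) (Set.range fun i : Fin n => B i.castSucc) := by
      intro h2
      apply h
      have h3 := Submodule.mem_map_of_mem
        (f := LinearMap.funLeft (ZMod 2) (ZMod 2) (Fin.castSucc : Fin n → Fin (n + 1))) h2
      rw [Submodule.map_span, ← Set.range_comp] at h3
      have h4 : (LinearMap.funLeft (ZMod 2) (ZMod 2) (Fin.castSucc : Fin n → Fin (n + 1))) ∘
          (fun i : Fin n => B i.castSucc) = fun i : Fin n => A i := by
        funext i j; exact hBA i j
      rw [h4] at h3
      exact h3
    rw [rank_snoc_not_mem B h2, hBC, h1]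

/-- The symmetric extension of `A` by the vector `v` and the corner `d`. -/
def extMat {n : ℕ} (A : Matrix (Fin n) (Fin n) (ZMod 2)) (d : ZMod 2) (v : Fin n → ZMod 2) :
    Matrix (Fin (n + 1)) (Fin (n + 1)) (ZMod 2) :=
  Fin.snoc (α := fun _ => Fin (n + 1) → ZMod 2)
    (fun i => Fin.snoc (α := fun _ => ZMod 2) (A i) (v i)) (Fin.snoc (α := fun _ => ZMod 2) v d)

theorem extMat_inj {n : ℕ} (A : Matrix (Fin n) (Fin n) (ZMod 2)) (d : ZMod 2) :
    Function.Injective (extMat A d) := by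
  intro v w h
  funext i
  have := congrFun (congrFun h (Fin.last n)) i.castSucc
  simpa [extMat] using this

theorem extMat_props {n : ℕ} (A : Matrix (Fin n) (Fin n) (ZMod 2)) (hA : A.IsSymm) (d : ZMod 2)
    (v : Fin n → ZMod 2) : (extMat A d v).IsSymm ∧
      (∀ i j : Fin n, extMat A d v i.castSucc j.castSucc = A i j) ∧
      extMat A d v (Fin.last n) (Fin.last n) = d ∧
      (fun i : Fin n => extMat A d v (Fin.last n) i.castSucc) = v := by
  refine ⟨?_, fun i j => by simp [extMat], by simp [extMat], by simp [extMat]⟩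
  apply Matrix.IsSymm.ext
  intro i j
  induction i using Fin.lastCases with
  | last =>
    induction j using Fin.lastCases with
    | last => rfl
    | cast j => simp [extMat]
  | cast i =>
    induction j using Fin.lastCases with
    | last => simp [extMat]
    | cast j => simpa [extMat] using hA.apply i j

theorem eq_extMat {n : ℕ} (A : Matrix (Fin n) (Fin n) (ZMod 2)) (d : ZMod 2)
    (B : Matrix (Fin (n + 1)) (Fin (n + 1)) (ZMod 2)) (hB : B.IsSymm)
    (hBA : ∀ i j : Fin n, B i.castSucc j.castSucc = A i j)
    (hd : B (Fin.last n) (Fin.last n) = d) :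
    extMat A d (fun i : Fin n => B (Fin.last n) i.castSucc) = B := by
  ext i j
  induction i using Fin.lastCases with
  | last =>
    induction j using Fin.lastCases with
    | last => simp [extMat, hd]
    | cast j => simp [extMat]
  | cast i =>
    induction j using Fin.lastCases with
    | last => simpa [extMat] using hB.apply _ _
    | cast j => simp [extMat, hBA]


/-- extending a symmetric matrix `A` over `𝔽₂` of rank `n - r` (with `r ≥ 1`)
by one symmetric row/column with prescribed corner entry `d`: if the new row's first `n`
entries lie in the row space of `A` then the rank grows by at most `1`, otherwise by
exactly `2`; in particular, among the `2ⁿ` such extensions exactly `2^{n-r}` have rank at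
most `rank A + 1` and the remaining `2ⁿ - 2^{n-r}` have rank `rank A + 2`. -/
theorem symmetric_matrix_extension_rank (n r : ℕ) (hr : 1 ≤ r) (hrn : r ≤ n)
    (A : Matrix (Fin n) (Fin n) (ZMod 2)) (hA : A.IsSymm) (hrank : A.rank = n - r)
    (d : ZMod 2) :
    (∀ B : Matrix (Fin (n + 1)) (Fin (n + 1)) (ZMod 2), B.IsSymm →
      (∀ i j : Fin n, B i.castSucc j.castSucc = A i j) →
      B (Fin.last n) (Fin.last n) = d →
      (((fun i : Fin n => B (Fin.last n) i.castSucc) ∈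
          Submodule.span (ZMod 2) (Set.range fun i : Fin n => A i) →
        B.rank ≤ A.rank + 1) ∧
       ((fun i : Fin n => B (Fin.last n) i.castSucc) ∉
          Submodule.span (ZMod 2) (Set.range fun i : Fin n => A i) →
        B.rank = A.rank + 2))) ∧
    {B : Matrix (Fin (n + 1)) (Fin (n + 1)) (ZMod 2) | B.IsSymm ∧
        (∀ i j : Fin n, B i.castSucc j.castSucc = A i j) ∧
        B (Fin.last n) (Fin.last n) = d ∧ B.rank ≤ A.rank + 1}.ncard = 2 ^ (n - r) ∧
    {B : Matrix (Fin (n + 1)) (Fin (n + 1)) (ZMod 2) | B.IsSymm ∧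
        (∀ i j : Fin n, B i.castSucc j.castSucc = A i j) ∧
        B (Fin.last n) (Fin.last n) = d ∧ B.rank = A.rank + 2}.ncard =
      2 ^ n - 2 ^ (n - r) := by
  refine ⟨fun B hB hBA _ => rank_ext_aux A B hB hBA, ?_⟩
  set S := Submodule.span (ZMod 2) (Set.range fun i : Fin n => A i) with hS
  have hcard : (S : Set (Fin n → ZMod 2)).ncard = 2 ^ (n - r) := by
    classical
    rw [← Nat.card_coe_set_eq]
    have h1 := Module.natCard_eq_pow_finrank (K := ZMod 2) (V := S)
    have h2 : Module.finrank (ZMod 2) S = n - r := by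
      rw [← hrank, Matrix.rank_eq_finrank_span_row]; rfl
    rw [h2, Nat.card_zmod] at h1
    exact h1
  constructor
  · rw [← hcard, ← Set.ncard_image_of_injective _ (extMat_inj A d)]
    congr 1
    ext B
    constructor
    · rintro ⟨h1, h2, h3, h4⟩
      refine ⟨_, ?_, eq_extMat A d B h1 h2 h3⟩
      by_contra h
      have := (rank_ext_aux A B h1 h2).2 h
      omega
    · rintro ⟨v, hv, rfl⟩
      obtain ⟨h1, h2, h3, h4⟩ := extMat_props A hA d v
      exact ⟨h1, h2, h3, (rank_ext_aux A _ h1 h2).1 (by rw [h4]; exact hv)⟩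
  · have hc : ((S : Set (Fin n → ZMod 2))ᶜ).ncard = 2 ^ n - 2 ^ (n - r) := by
      rw [Set.ncard_compl, hcard]
      simp
    rw [← hc, ← Set.ncard_image_of_injective _ (extMat_inj A d)]
    congr 1
    ext B
    constructor
    · rintro ⟨h1, h2, h3, h4⟩
      refine ⟨_, ?_, eq_extMat A d B h1 h2 h3⟩
      intro h
      have := (rank_ext_aux A B h1 h2).1 h
      omega
    · rintro ⟨v, hv, rfl⟩
      obtain ⟨h1, h2, h3, h4⟩ := extMat_props A hA d v
      exact ⟨h1, h2, h3, (rank_ext_aux A _ h1 h2).2 (by rw [h4]; exact hv)⟩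
end

section
/- Let T be a tournament on vertex set [n] = {1,…,n} and let σ be a permutation of [n]. Then inv_σ(T) ≥ min over diagonal matrices D ∈ 𝔽₂^{n×n} of rank(M_σ(T) + D). Equivalently, if T can be transformed into the transitive tournament with acyclic ordering σ by inverting k subsets of [n], then there exists a diagonal matrix D ∈ 𝔽₂^{n×n} with rank(M_σ(T) + D) ≤ k. -/
open Classical in
/-- The matrix `M_σ(T)`: symmetric over `𝔽₂`, zero diagonal, and for `i ≠ j` the entry is
`0` iff the arc of `T` between `i` and `j` is oriented according to `σ` (from the
`σ`-earlier vertex to the `σ`-later one). -/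
noncomputable def Msigma {n : ℕ} (T : OrientedGraph (Fin n)) (σ : Equiv.Perm (Fin n)) :
    Matrix (Fin n) (Fin n) (ZMod 2) :=
  Matrix.of fun i j =>
    if i = j then 0
    else if (σ.symm i < σ.symm j ∧ T.arc i j) ∨ (σ.symm j < σ.symm i ∧ T.arc j i)
      then 0 else 1

/-- if the tournament `T` on `[n]` can be transformed into the transitive
tournament with acyclic ordering `σ` by inverting `k` subsets, then there is a diagonal
matrix `D` over `𝔽₂` with `rank (M_σ(T) + D) ≤ k`; i.e.
`inv_σ(T) ≥ min_D rank (M_σ(T) + D)`. -/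
theorem invSigma_ge_min_rank {n : ℕ} (T : OrientedGraph (Fin n)) (hT : T.IsTournament)
    (σ : Equiv.Perm (Fin n)) (k : ℕ) (X : Fin k → Set (Fin n))
    (hX : ∀ u v : Fin n, (T.invert X).arc u v ↔ σ.symm u < σ.symm v) :
    ∃ dvec : Fin n → ZMod 2, (Msigma T σ + Matrix.diagonal dvec).rank ≤ k := by
  classical
  let A : Matrix (Fin n) (Fin k) (ZMod 2) := Matrix.of fun v i => if v ∈ X i then 1 else 0
  have hA : ∀ u v, (A * A.transpose) u v
      = (({i : Fin k | u ∈ X i ∧ v ∈ X i}.ncard : ℕ) : ZMod 2) := by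
    intro u v
    rw [Set.ncard_eq_toFinset_card', Matrix.mul_apply]
    simp only [A, Matrix.transpose_apply, Matrix.of_apply, ← ite_and, mul_ite, mul_one, mul_zero]
    rw [Finset.sum_boole]
    congr 2
    ext i
    simp [and_comm]
  refine ⟨fun v => (A * A.transpose) v v, ?_⟩
  have key : Msigma T σ + Matrix.diagonal (fun v => (A * A.transpose) v v)
      = A * A.transpose := by
    ext u v
    by_cases huv : u = v
    · subst huv
      simp [Msigma]
    · rw [Matrix.add_apply, Matrix.diagonal_apply_ne _ huv, add_zero, hA]
      have h1 := hX u v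
      have hne : σ.symm u ≠ σ.symm v := fun h => huv (σ.symm.injective h)
      have hs := T.asymm' u v
      have ht := hT u v huv
      simp only [OrientedGraph.invert] at h1
      simp only [Msigma, Matrix.of_apply, if_neg huv]
      by_cases hE : Even {i : Fin k | u ∈ X i ∧ v ∈ X i}.ncard
      · rw [(ZMod.natCast_eq_zero_iff_even).2 hE, if_pos]
        rcases lt_or_gt_of_ne hne with h | h
        · tauto
        · have := not_lt_of_gt h
          tauto
      · rw [(ZMod.natCast_eq_one_iff_odd).2 (Nat.not_even_iff_odd.1 hE), if_neg]
        rcases lt_or_gt_of_ne hne with h | h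
        · have := not_lt_of_gt h
          tauto
        · have := not_lt_of_gt h
          tauto
  rw [key]
  calc (A * A.transpose).rank ≤ A.rank := Matrix.rank_mul_le_left _ _
    _ ≤ k := by simpa using A.rank_le_width
end

section
/- For every odd integer k ≥ 3, there exists a tournament T_k together with pairwise disjoint sets A₁,…,A_{k−1} of vertices of T_k such that inv(T_k) = k and (A₁,…,A_{k−1}, A₁ ∪ ⋯ ∪ A_{k−1}) is a decycling family of T_k. -/
namespace SpecialDecycling

open Finset

/-- Indicator: both colours non-zero and distinct. -/
def M (i j : ℕ) : ZMod 2 := if i ≠ j ∧ i ≠ 0 ∧ j ≠ 0 then 1 else 0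

lemma M_comm (i j : ℕ) : M i j = M j i := by
  unfold M; congr 1; apply propext; tauto

lemma z01 (x : ZMod 2) : x = 0 ∨ x = 1 := by
  revert x; decide

lemma dep {p m : ℕ} (h : m < p + 1) (g : Fin (p + 1) → Fin m → ZMod 2)
    (hg : ∀ a : Fin (p + 1) → ZMod 2, ∑ i, a i • g i = 0 → ∀ i, a i = 0) : False := by
  have h1 : LinearIndependent (ZMod 2) g := Fintype.linearIndependent_iff.2 hg
  have h2 := h1.fintype_card_le_finrank
  simp at h2
  omega

lemma key {p m : ℕ} (hp : Even p) (hp0 : 2 ≤ p) (hm : m < p + 1)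
    (g : Fin (p + 1) → Fin m → ZMod 2) (c : ZMod 2)
    (h : ∀ i j, g i ⬝ᵥ g j = M i j + c) : False := by
  have hpz : (p : ZMod 2) = 0 := (ZMod.natCast_eq_zero_iff_even).2 hp
  rcases z01 c with rfl | rfl
  · -- replace the vector of colour zero by the all ones vector
    have hone : ∀ x : Fin m → ZMod 2, x ⬝ᵥ (fun _ => 1) = x ⬝ᵥ x := by
      intro x
      simp only [dotProduct]
      refine Finset.sum_congr rfl fun i _ => ?_
      rcases z01 (x i) with h | h <;> rw [h] <;> rfl
    have hmpos : 0 < m := by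
      rcases Nat.eq_zero_or_pos m with rfl | h0
      · exfalso
        have := h ⟨1, by omega⟩ ⟨2, by omega⟩
        simp [M, dotProduct] at this
      · exact h0
    refine dep hm (Fin.cons (fun _ => 1) (fun i => g i.succ)) fun a ha => ?_
    rw [Fin.sum_univ_succ] at ha
    simp only [Fin.cons_zero, Fin.cons_succ] at ha
    have hj : ∀ j : Fin p, a j.succ = ∑ i : Fin p, a i.succ := by
      intro j
      have h2 := congrArg (fun x => g j.succ ⬝ᵥ x) ha
      simp only [dotProduct_add, dotProduct_smul, dotProduct_zero, hone, h, dotProduct_sum] at h2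
      have h3 : ∀ i : Fin p, a i.succ • (M (j.succ : Fin (p+1)) (i.succ : Fin (p+1)) + 0)
          = a i.succ - (if j = i then a i.succ else 0) := by
        intro i
        by_cases hij : j = i
        · subst hij; simp [M]
        · have : (j : ℕ) ≠ i := fun h => hij (Fin.ext h)
          simp [M, hij, this]
      simp only [h3, Finset.sum_sub_distrib] at h2
      simp [M] at h2
      exact (sub_eq_zero.1 h2).symm
    have hS : ∑ i : Fin p, a i.succ = 0 := by
      have : ∑ j : Fin p, a j.succ = ∑ j : Fin p, ∑ i : Fin p, a i.succ :=
        Finset.sum_congr rfl fun j _ => hj j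
      rw [this]
      simp [hpz]
    have hz : ∀ j : Fin p, a j.succ = 0 := fun j => (hj j).trans hS
    simp only [hz, zero_smul, Finset.sum_const_zero, add_zero] at ha
    have ha0 := congrFun ha ⟨0, hmpos⟩
    simp at ha0
    intro i
    exact Fin.cases ha0 hz i
  · refine dep hm g fun a ha => ?_
    have hM : ∀ i : Fin (p+1), M ((0 : Fin (p+1)) : ℕ) i = 0 := by intro i; simp [M]
    have h0 : ∑ i, a i = 0 := by
      have h2 := congrArg (fun x => g 0 ⬝ᵥ x) ha
      simpa [dotProduct_sum, dotProduct_smul, h, M] using h2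
    have hj : ∀ j : Fin p, a 0 + a j.succ = 0 := by
      intro j
      have h2 := congrArg (fun x => g j.succ ⬝ᵥ x) ha
      simp only [dotProduct_sum, dotProduct_smul, h, dotProduct_zero] at h2
      rw [Fin.sum_univ_succ] at h2
      have h3 : ∀ i : Fin p, a i.succ • (M (j.succ : Fin (p+1)) (i.succ : Fin (p+1)) + 1)
          = (if j = i then a i.succ else 0) := by
        intro i
        by_cases hij : j = i
        · subst hij; simp [M]
        · have : (j : ℕ) ≠ i := fun h => hij (Fin.ext h)
          have h11 : (1 : ZMod 2) + 1 = 0 := rfl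
          simp [M, hij, this, h11]
      simp only [h3] at h2
      simpa [M] using h2
    have hj' : ∀ j : Fin p, a j.succ = a 0 := by
      intro j
      have tw : ∀ x y : ZMod 2, x + y = 0 → y = x := by decide
      exact tw _ _ (hj j)
    rw [Fin.sum_univ_succ] at h0
    simp [hj', hpz] at h0
    intro i
    exact Fin.cases h0 (fun j => (hj' j).trans h0) i

/-- The tournament. -/
def T (k n : ℕ) : OrientedGraph (Fin n) where
  arc u v := (M (u % k) (v % k) = 0 ∧ u < v) ∨ (M (u % k) (v % k) = 1 ∧ v < u)
  irrefl' v h := by rcases h with h | h <;> exact lt_irrefl _ h.2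
  asymm' u v h1 h2 := by
    rw [M_comm (v % k)] at h2
    rcases h1 with ⟨a, b⟩ | ⟨a, b⟩ <;> rcases h2 with ⟨c, d⟩ | ⟨c, d⟩
    · exact lt_asymm b d
    · rw [a] at c; exact absurd c (by decide)
    · rw [a] at c; exact absurd c (by decide)
    · exact lt_asymm b d

lemma T_tour (k n : ℕ) : (T k n).IsTournament := by
  intro u v huv
  have := M_comm (u % k) (v % k)
  rcases lt_or_gt_of_ne huv with h | h <;> rcases z01 (M (u % k) (v % k)) with h' | h'
  · exact Or.inl (Or.inl ⟨h', h⟩)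
  · exact Or.inr (Or.inr ⟨this ▸ h', h⟩)
  · exact Or.inr (Or.inl ⟨this ▸ h', h⟩)
  · exact Or.inl (Or.inr ⟨h', h⟩)

open Classical in
/-- Characteristic vectors. -/
noncomputable def cv {V : Type*} {m : ℕ} (X : Fin m → Set V) (u : V) : Fin m → ZMod 2 :=
  fun x => if u ∈ X x then 1 else 0

lemma even_iff {V : Type*} {m : ℕ} (X : Fin m → Set V) (u v : V) :
    Even {i : Fin m | u ∈ X i ∧ v ∈ X i}.ncard ↔ cv X u ⬝ᵥ cv X v = 0 := by
  classical
  rw [← ZMod.natCast_eq_zero_iff_even]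
  have : ({i : Fin m | u ∈ X i ∧ v ∈ X i}.ncard : ZMod 2) = cv X u ⬝ᵥ cv X v := by
    rw [Set.ncard_eq_toFinset_card']
    simp only [dotProduct, cv, Set.toFinset_setOf, Finset.card_filter, Nat.cast_sum]
    refine Finset.sum_congr rfl fun i _ => ?_
    by_cases h1 : u ∈ X i <;> by_cases h2 : v ∈ X i <;> simp [h1, h2]
  rw [this]

lemma arc_of_zero {k n m : ℕ} (X : Fin m → Set (Fin n)) {u v : Fin n} (h : u < v)
    (he : M (u % k) (v % k) + cv X u ⬝ᵥ cv X v = 0) : ((T k n).invert X).arc u v := by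
  rcases z01 (M (u % k) (v % k)) with h' | h'
  · left
    refine ⟨(even_iff X u v).2 (by simpa [h'] using he), Or.inl ⟨h', h⟩⟩
  · right
    refine ⟨fun hh => ?_, Or.inr ⟨M_comm _ _ ▸ h', h⟩⟩
    rw [even_iff] at hh
    rw [hh, h'] at he
    exact absurd he (by decide)

lemma arc_of_one {k n m : ℕ} (X : Fin m → Set (Fin n)) {u v : Fin n} (h : u < v)
    (he : M (u % k) (v % k) + cv X u ⬝ᵥ cv X v = 1) : ((T k n).invert X).arc v u := by
  rcases z01 (M (u % k) (v % k)) with h' | h'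
  · right
    refine ⟨fun hh => ?_, Or.inl ⟨h', h⟩⟩
    rw [even_iff, dotProduct_comm] at hh
    rw [hh, h'] at he
    exact absurd he (by decide)
  · left
    refine ⟨(even_iff X v u).2 ?_, Or.inr ⟨M_comm _ _ ▸ h', h⟩⟩
    rw [dotProduct_comm]
    simpa [h'] using he

lemma tri {k n m : ℕ} {X : Fin m → Set (Fin n)} (hX : (T k n).IsDecycling X)
    {u v w : Fin n} (huv : u < v) (hvw : v < w) (c : ZMod 2)
    (h1 : M (u % k) (v % k) + cv X u ⬝ᵥ cv X v = c)
    (h2 : M (v % k) (w % k) + cv X v ⬝ᵥ cv X w = c) :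
    M (u % k) (w % k) + cv X u ⬝ᵥ cv X w = c := by
  by_contra h3
  rcases z01 c with rfl | rfl
  · have h3 := (z01 _).resolve_left h3
    exact hX u (((Relation.TransGen.single (arc_of_zero X huv h1)).tail
      (arc_of_zero X hvw h2)).tail (arc_of_one X (huv.trans hvw) h3))
  · have h3 := (z01 _).resolve_right h3
    exact hX u (((Relation.TransGen.single (arc_of_zero X (huv.trans hvw) h3)).tail
      (arc_of_one X hvw h2)).tail (arc_of_one X huv h1))

lemma M_self (i : ℕ) : M i i = 0 := by simp [M]

lemma lower {p m R : ℕ} (hp : Even p) (hp0 : 2 ≤ p) (hm : m < p + 1)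
    (hR : (2 ^ m) ^ (p + 1) < R) (X : Fin m → Set (Fin (R * (p + 1))))
    (hX : (T (p + 1) (R * (p + 1))).IsDecycling X) : False := by
  have hlt : ∀ (b : Fin R) (i : Fin (p + 1)), (b : ℕ) * (p + 1) + i < R * (p + 1) := by
    intro b i
    calc (b : ℕ) * (p + 1) + i < b * (p + 1) + (p + 1) := by omega
      _ = (b + 1) * (p + 1) := by ring
      _ ≤ R * (p + 1) := Nat.mul_le_mul_right _ b.2
  let V : Fin R → Fin (p + 1) → Fin (R * (p + 1)) := fun b i => ⟨b * (p + 1) + i, hlt b i⟩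
  have hcol : ∀ b i, ((V b i : Fin _) : ℕ) % (p + 1) = i := by
    intro b i
    change ((b : ℕ) * (p + 1) + i) % (p + 1) = i
    rw [Nat.mul_comm, Nat.mul_add_mod, Nat.mod_eq_of_lt i.2]
  obtain ⟨b, b', hne, hf⟩ := Fintype.exists_ne_map_eq_of_card_lt
    (fun b : Fin R => fun i : Fin (p + 1) => cv X (V b i)) (by simpa using hR)
  wlog hbb : b < b' generalizing b b'
  · exact this b' b hne.symm hf.symm (lt_of_le_of_ne (not_lt.1 hbb) hne.symm)
  have hf' : ∀ i, cv X (V b' i) = cv X (V b i) := fun i => (congrFun hf i).symm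
  have hin : ∀ b {i j : Fin (p + 1)}, i < j → V b i < V b j := by
    intro b i j hij
    change (b : ℕ) * (p + 1) + i < b * (p + 1) + j
    have : (i : ℕ) < j := hij
    omega
  have hout : ∀ i j : Fin (p + 1), V b i < V b' j := by
    intro i j
    change (b : ℕ) * (p + 1) + i < b' * (p + 1) + j
    have h1 : ((b : ℕ) + 1) * (p + 1) ≤ b' * (p + 1) := Nat.mul_le_mul_right _ hbb
    have h2 : ((b : ℕ) + 1) * (p + 1) = b * (p + 1) + (p + 1) := by ring
    have := i.2
    omega
  let g : Fin (p + 1) → Fin m → ZMod 2 := fun i => cv X (V b i)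
  have main : ∀ i j, i < j → g i ⬝ᵥ g i = M i j + g i ⬝ᵥ g j ∧
      g j ⬝ᵥ g j = M i j + g i ⬝ᵥ g j := by
    intro i j hij
    have t1 := tri hX (hin b hij) (hout j i) (M i j + g i ⬝ᵥ g j) (by rw [hcol, hcol])
      (by rw [hcol, hcol, hf', M_comm, dotProduct_comm])
    have t2 := tri hX (hout j i) (hin b' hij) (M i j + g i ⬝ᵥ g j)
      (by rw [hcol, hcol, hf', M_comm, dotProduct_comm]) (by rw [hcol, hcol, hf', hf'])
    rw [hcol, hcol, hf', M_self, zero_add] at t1 t2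
    exact ⟨t1, t2⟩
  have hd : ∀ i, g i ⬝ᵥ g i = g 0 ⬝ᵥ g 0 := by
    intro i
    rcases eq_or_ne i 0 with rfl | h
    · rfl
    · have := main 0 i (Fin.pos_of_ne_zero h)
      rw [this.1, this.2]
  have tw : ∀ x y z : ZMod 2, x = y + z → z = y + x := by decide
  refine key hp hp0 hm g (g 0 ⬝ᵥ g 0) fun i j => ?_
  rcases lt_trichotomy i j with h | rfl | h
  · rw [← hd i]; exact tw _ _ _ (main i j h).1
  · rw [hd, M_self, zero_add]
  · rw [← hd j, dotProduct_comm, M_comm]; exact tw _ _ _ (main j i h).1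

lemma upper (p n : ℕ) :
    let A : Fin p → Set (Fin n) := fun i => {v | (v : ℕ) % (p + 1) = i + 1}
    (T (p + 1) n).IsDecycling (Fin.snoc A (⋃ i, A i) : Fin (p + 1) → Set (Fin n)) := by
  intro A
  have hU : ∀ v, v ∈ (⋃ i, A i) ↔ (v : ℕ) % (p + 1) ≠ 0 := by
    intro v
    simp only [Set.mem_iUnion, A, Set.mem_setOf_eq]
    constructor
    · rintro ⟨i, hi⟩; omega
    · intro h
      have : (v : ℕ) % (p + 1) < p + 1 := Nat.mod_lt _ (Nat.succ_pos p)
      exact ⟨⟨(v : ℕ) % (p + 1) - 1, by omega⟩, by simp only; omega⟩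
  have hdot : ∀ u v, cv (Fin.snoc A (⋃ i, A i) : Fin (p + 1) → Set (Fin n)) u ⬝ᵥ
      cv (Fin.snoc A (⋃ i, A i) : Fin (p + 1) → Set (Fin n)) v
      = M (u % (p + 1)) (v % (p + 1)) := by
    classical
    intro u v
    simp only [dotProduct, Fin.sum_univ_castSucc, cv, Fin.snoc_castSucc, Fin.snoc_last, hU]
    by_cases hu : (u : ℕ) % (p + 1) = 0
    · have : ∀ i, u ∉ A i := fun i hi => (hU u).1 (Set.mem_iUnion.2 ⟨i, hi⟩) hu
      simp [this, hu, M]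
    · obtain ⟨i, hi⟩ := Set.mem_iUnion.1 ((hU u).2 hu)
      have hi' : (u : ℕ) % (p + 1) = i + 1 := hi
      have hA : ∀ x, u ∈ A x ↔ i = x := by
        intro x
        constructor
        · intro h
          have h : (u : ℕ) % (p + 1) = x + 1 := h
          exact Fin.ext (by omega)
        · rintro rfl; exact hi
      simp only [hA, ite_mul, one_mul, zero_mul, Finset.sum_ite_eq, Finset.mem_univ, if_true]
      have hv : v ∈ A i ↔ (u : ℕ) % (p + 1) = (v : ℕ) % (p + 1) := by
        rw [hi']; exact eq_comm
      have h11 : (1 : ZMod 2) + 1 = 0 := rfl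
      by_cases h1 : (u : ℕ) % (p + 1) = (v : ℕ) % (p + 1)
      · have : (v : ℕ) % (p + 1) ≠ 0 := h1 ▸ hu
        simp [hv, h1, M, this, h11]
      · by_cases h2 : (v : ℕ) % (p + 1) = 0 <;> simp [hv, h1, h2, M, hu]
  have harc : ∀ u v, ((T (p + 1) n).invert
      (Fin.snoc A (⋃ i, A i) : Fin (p + 1) → Set (Fin n))).arc u v → u < v := by
    intro u v h
    rcases h with ⟨h1, h2⟩ | ⟨h1, h2⟩
    · rw [even_iff, hdot] at h1
      rcases h2 with h2 | h2
      · exact h2.2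
      · rw [h1] at h2; exact absurd h2.1 (by decide)
    · rw [even_iff, hdot, M_comm] at h1
      rcases h2 with h2 | h2
      · exact absurd h2.1 h1
      · exact h2.2
  intro v hv
  have : ∀ w, Relation.TransGen ((T (p + 1) n).invert
      (Fin.snoc A (⋃ i, A i) : Fin (p + 1) → Set (Fin n))).arc v w → v < w := by
    intro w hw
    induction hw with
    | single h => exact harc _ _ h
    | tail _ h ih => exact ih.trans (harc _ _ h)
  exact lt_irrefl _ (this v hv)

end SpecialDecycling

/-- for every odd `k ≥ 3` there is a tournament `T_k` with `inv(T_k) = k`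
having pairwise disjoint vertex sets `A₁, …, A_{k-1}` such that
`(A₁, …, A_{k-1}, A₁ ∪ ⋯ ∪ A_{k-1})` is a decycling family of `T_k`. -/
theorem exists_tournament_special_decycling (k : ℕ) (hk : 3 ≤ k) (hodd : Odd k) :
    ∃ (n : ℕ) (T : OrientedGraph (Fin n)), T.IsTournament ∧ T.inv = k ∧
      ∃ (m : ℕ) (_ : k = m + 1) (A : Fin m → Set (Fin n)),
        (∀ i j : Fin m, i ≠ j → Disjoint (A i) (A j)) ∧
        T.IsDecycling (Fin.snoc A (⋃ i, A i)) := by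
  obtain ⟨q, hq⟩ := hodd
  obtain ⟨p, rfl⟩ : ∃ p, k = p + 1 := ⟨2 * q, hq⟩
  have hp : Even p := ⟨q, by omega⟩
  refine ⟨((2 ^ (p + 1)) ^ (p + 1) + 1) * (p + 1), SpecialDecycling.T (p + 1) _,
    SpecialDecycling.T_tour _ _, ?_, p, rfl,
    fun i => {v | (v : ℕ) % (p + 1) = i + 1}, ?_, SpecialDecycling.upper p _⟩
  · refine le_antisymm (Nat.sInf_le ⟨_, SpecialDecycling.upper p _⟩)
      (le_csInf ⟨_, _, SpecialDecycling.upper p _⟩ ?_)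
    rintro m ⟨X, hX⟩
    by_contra hm
    refine SpecialDecycling.lower hp (by omega) (not_le.1 hm) ?_ X hX
    refine Nat.lt_succ_of_le (Nat.pow_le_pow_left (Nat.pow_le_pow_right (by norm_num) ?_) _)
    omega
  · intro i j hij
    rw [Set.disjoint_left]
    intro v h1 h2
    simp only [Set.mem_setOf_eq] at h1 h2
    exact hij (Fin.ext (by omega))
end

section
/- Let m ≥ 2 be an even integer and let M ∈ 𝔽₂^{m×m} be the matrix whose diagonal entries are all 0 and whose off-diagonal entries are all 1. Then M² equals the identity matrix I_m (so M has full rank m), and there is no matrix U ∈ 𝔽₂^{m×m} satisfying Uᵀ·U = M. -/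
/-- for even `m ≥ 2`, the `m × m` matrix `M` over `𝔽₂` with zero diagonal
and all off-diagonal entries `1` satisfies `M² = I` (so `M` has full rank `m`), and no
matrix `U` satisfies `Uᵀ · U = M`. -/
theorem all_ones_minus_id_not_gram (m : ℕ) (hm : 2 ≤ m) (hev : Even m)
    (M : Matrix (Fin m) (Fin m) (ZMod 2))
    (hM : ∀ i j : Fin m, M i j = if i = j then 0 else 1) :
    M * M = 1 ∧ M.rank = m ∧
      ∀ U : Matrix (Fin m) (Fin m) (ZMod 2), U.transpose * U ≠ M := by
  have hsq : M * M = 1 := by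
    have hJ : M = Matrix.of (fun _ _ => (1 : ZMod 2)) + 1 := by
      ext i j
      rw [hM, Matrix.add_apply, Matrix.of_apply, Matrix.one_apply]
      split_ifs
      · decide
      · decide
    have hm0 : (m : ZMod 2) = 0 := (ZMod.natCast_eq_zero_iff_even).2 hev
    have hJJ : (Matrix.of (fun _ _ => (1 : ZMod 2)) : Matrix (Fin m) (Fin m) (ZMod 2)) *
        Matrix.of (fun _ _ => (1 : ZMod 2)) = 0 := by
      ext i j
      simp [Matrix.mul_apply, hm0]
    rw [hJ, add_mul, mul_add, hJJ, mul_one, one_mul, zero_add, ← add_assoc]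
    ext i j
    simp only [Matrix.add_apply, Matrix.of_apply]
    rw [CharTwo.add_self_eq_zero, zero_add]
  refine ⟨hsq, ?_, ?_⟩
  · have hu : IsUnit M := IsUnit.of_mul_eq_one M hsq
    rw [Matrix.rank_of_isUnit M hu, Fintype.card_fin]
  · intro U hU
    have h1 : (M * U.transpose) * U = 1 := by rw [Matrix.mul_assoc, hU, hsq]
    have h2 : U * (M * U.transpose) = 1 := mul_eq_one_comm.1 h1
    have h3 : Matrix.vecMul (fun _ => (1 : ZMod 2)) U = 0 := by
      ext j
      have hj : (U.transpose * U) j j = 0 := by rw [hU, hM]; simp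
      rw [Matrix.mul_apply] at hj
      simp only [Matrix.vecMul, dotProduct, Pi.zero_apply, one_mul]
      rw [← hj]
      refine Finset.sum_congr rfl fun i _ => ?_
      rw [Matrix.transpose_apply]
      generalize U i j = a
      revert a
      decide
    have h4 : (fun _ : Fin m => (1 : ZMod 2)) = 0 := by
      rw [← Matrix.vecMul_one (fun _ : Fin m => (1 : ZMod 2)), ← h2,
        ← Matrix.vecMul_vecMul, h3, Matrix.zero_vecMul]
    have h5 := congrFun h4 ⟨0, by omega⟩
    exact one_ne_zero h5
end

section
/- For every odd integer k ≥ 3, there exists a tournament T_k with inv(T_k) = k such that for every oriented graph R with inv(R) ≥ 1, inv(T_k ⇒ R) ≤ k + inv(R) − 1. In particular, the equality inv(L ⇒ R) = inv(L) + inv(R) fails for some pairs of oriented graphs. -/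
open scoped Classical in
/-- Indicator vector over `ZMod 2` of the sets containing a vertex. -/
noncomputable def indVec {V : Type*} {k : ℕ} (X : Fin k → Set V) (u : V) (i : Fin k) : ZMod 2 :=
  if u ∈ X i then 1 else 0

lemma indVec_congr {V W : Type*} {k l : ℕ} (X : Fin k → Set V) (Y : Fin l → Set W) {u : V} {v : W}
    {i : Fin k} {j : Fin l} (h : u ∈ X i ↔ v ∈ Y j) : indVec X u i = indVec Y v j := by
  by_cases h' : v ∈ Y j
  · simp [indVec, h', h.2 h']
  · have h2 : u ∉ X i := fun h3 => h' (h.1 h3)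
    simp [indVec, h', h2]

lemma indVec_zero {V : Type*} {k : ℕ} (X : Fin k → Set V) {u : V}
    {i : Fin k} (h : u ∉ X i) : indVec X u i = 0 := by
  simp [indVec, h]

lemma even_ncard_iff {V : Type*} {k : ℕ} (X : Fin k → Set V) (u v : V) :
    Even {i : Fin k | u ∈ X i ∧ v ∈ X i}.ncard ↔ ∑ i, indVec X u i * indVec X v i = 0 := by
  classical
  have h : ∑ i, indVec X u i * indVec X v i
      = (({i : Fin k | u ∈ X i ∧ v ∈ X i}.ncard : ℕ) : ZMod 2) := by
    rw [Set.ncard_eq_toFinset_card', Finset.card_eq_sum_ones, Nat.cast_sum]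
    simp only [Set.toFinset_setOf, Finset.sum_filter, Nat.cast_one]
    refine Finset.sum_congr rfl fun i _ => ?_
    by_cases h1 : u ∈ X i <;> by_cases h2 : v ∈ X i <;> simp [indVec, h1, h2]
  rw [h, ZMod.natCast_eq_zero_iff_even]

lemma zmod2_ne_zero {a : ZMod 2} (h : a ≠ 0) : a = 1 := by
  revert h; revert a; decide

lemma zmod2_cases (a : ZMod 2) : a = 0 ∨ a = 1 := by
  revert a; decide

/-- Linear algebra: an alternating Gram matrix of full rank `m` is not realised in `F_2^j`
with `j ≤ m`. -/
lemma no_gram (m j : ℕ) (hm : 0 < m) (he : Even m) (hj : j ≤ m) (g : Fin m → Fin j → ZMod 2)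
    (h : ∀ a b, ∑ i, g a i * g b i = (if a = b then 1 else 0) + 1) : False := by
  let F : Matrix (Fin m) (Fin j) (ZMod 2) := Matrix.of g
  let G : Matrix (Fin m) (Fin m) (ZMod 2) := Matrix.of fun a b => (if a = b then 1 else 0) + 1
  have hG : F * F.transpose = G := by
    ext a b
    simpa [F, G, Matrix.mul_apply] using h a b
  have hm0 : (m : ZMod 2) = 0 := (ZMod.natCast_eq_zero_iff_even).2 he
  have hGG : G * G = 1 := by
    ext a b
    simp only [G, Matrix.mul_apply, Matrix.of_apply, add_mul, mul_add, Finset.sum_add_distrib,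
      Matrix.one_apply]
    by_cases hab : a = b
    · simp [hab, hm0]
      try decide
    · simp [hab, hm0]
      try decide
  have hu : IsUnit G := IsUnit.of_mul_eq_one G hGG
  have hr : G.rank = m := by rw [Matrix.rank_of_isUnit G hu, Fintype.card_fin]
  have hjm : m ≤ j := by
    rw [← hr, ← hG]
    exact (Matrix.rank_mul_le_left _ _).trans (Matrix.rank_le_width F)
  obtain rfl : j = m := le_antisymm hj hjm
  have h1 : F * (F.transpose * G) = 1 := by rw [← Matrix.mul_assoc, hG, hGG]
  have h2 : (F.transpose * G) * F = 1 := mul_eq_one_comm.1 h1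
  have h3 : F.mulVec 1 = 0 := by
    ext a
    have := h a a
    simp only [Matrix.mulVec, dotProduct, F, Matrix.of_apply, Pi.one_apply, mul_one, Pi.zero_apply]
    have hs : ∀ c : ZMod 2, c * c = c := by decide
    simp only [hs, if_true] at this
    rw [this]; decide
  have h4 : (1 : Fin j → ZMod 2) = 0 := by
    calc (1 : Fin j → ZMod 2) = ((F.transpose * G) * F).mulVec 1 := by rw [h2, Matrix.one_mulVec]
      _ = (F.transpose * G).mulVec (F.mulVec 1) := by rw [Matrix.mulVec_mulVec]
      _ = 0 := by rw [h3, Matrix.mulVec_zero]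
  have := congrFun h4 ⟨0, hm⟩
  simp at this

/-- The tournament on `Fin n` obtained from the natural order by reversing the pairs with odd
inner product. -/
def vecTour {n k : ℕ} (x : Fin n → Fin k → ZMod 2) : OrientedGraph (Fin n) where
  arc u v := (u < v ∧ ∑ i, x u i * x v i = 0) ∨ (v < u ∧ ∑ i, x u i * x v i = 1)
  irrefl' v h := by
    rcases h with h | h <;> exact lt_irrefl _ h.1
  asymm' u v h1 h2 := by
    have hc : ∑ i, x v i * x u i = ∑ i, x u i * x v i :=
      Finset.sum_congr rfl fun i _ => mul_comm _ _
    rw [hc] at h2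
    rcases h1 with h1 | h1 <;> rcases h2 with h2 | h2
    · exact lt_asymm h1.1 h2.1
    · exact absurd (h1.2.symm.trans h2.2) (by decide)
    · exact absurd (h2.2.symm.trans h1.2) (by decide)
    · exact lt_asymm h1.1 h2.1

lemma vecTour_isTournament {n k : ℕ} (x : Fin n → Fin k → ZMod 2) :
    (vecTour x).IsTournament := by
  intro u v huv
  have hc : ∑ i, x v i * x u i = ∑ i, x u i * x v i :=
    Finset.sum_congr rfl fun i _ => mul_comm _ _
  simp only [vecTour, hc]
  rcases zmod2_cases (∑ i, x u i * x v i) with h | h <;> rcases lt_or_gt_of_ne huv with h' | h' <;>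
    simp [h, h']

/-- Forward arcs after inversion. -/
lemma invert_arc_fwd {n k j : ℕ} (x : Fin n → Fin k → ZMod 2) (X : Fin j → Set (Fin n))
    {u v : Fin n} (huv : u < v)
    (h : ∑ i, indVec X u i * indVec X v i = ∑ i, x u i * x v i) :
    ((vecTour x).invert X).arc u v := by
  have hc : ∑ i, x v i * x u i = ∑ i, x u i * x v i :=
    Finset.sum_congr rfl fun i _ => mul_comm _ _
  simp only [OrientedGraph.invert, even_ncard_iff, vecTour, hc, h]
  rcases zmod2_cases (∑ i, x u i * x v i) with h | h <;> simp [h, huv]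

/-- Backward arcs after inversion. -/
lemma invert_arc_bwd {n k j : ℕ} (x : Fin n → Fin k → ZMod 2) (X : Fin j → Set (Fin n))
    {u v : Fin n} (huv : u < v)
    (h : ∑ i, indVec X u i * indVec X v i = ∑ i, x u i * x v i + 1) :
    ((vecTour x).invert X).arc v u := by
  have hc : ∑ i, x v i * x u i = ∑ i, x u i * x v i :=
    Finset.sum_congr rfl fun i _ => mul_comm _ _
  have hc' : ∑ i, indVec X v i * indVec X u i = ∑ i, indVec X u i * indVec X v i :=
    Finset.sum_congr rfl fun i _ => mul_comm _ _
  simp only [OrientedGraph.invert, even_ncard_iff, vecTour, hc, hc', h]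
  have h2 : (1 + 1 : ZMod 2) = 0 := by decide
  rcases zmod2_cases (∑ i, x u i * x v i) with h | h <;> simp [h, huv, h2]

lemma indVec_vec {n k : ℕ} (x : Fin n → Fin k → ZMod 2) (u : Fin n) (i : Fin k) :
    indVec (fun i => {v | x v i = 1}) u i = x u i := by
  rcases zmod2_cases (x u i) with h | h <;> simp [indVec, h]

lemma vecTour_decycling {n k : ℕ} (x : Fin n → Fin k → ZMod 2) :
    (vecTour x).IsDecycling (fun i => {v | x v i = 1}) := by
  have key : ∀ u v, ((vecTour x).invert (fun i => {v | x v i = 1})).arc u v → u < v := by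
    intro u v h
    rcases lt_trichotomy u v with h' | h' | h'
    · exact h'
    · subst h'; exact absurd h (OrientedGraph.irrefl' _ u)
    · refine absurd h (OrientedGraph.asymm' _ v u (invert_arc_fwd x _ h' ?_))
      simp only [indVec_vec]
  have key2 : ∀ u v, Relation.TransGen
      ((vecTour x).invert (fun i => {v | x v i = 1})).arc u v → u < v := by
    intro u v h
    induction h with
    | single h => exact key _ _ h
    | tail _ h ih => exact ih.trans (key _ _ h)
  intro v h
  exact lt_irrefl _ (key2 v v h)

lemma no_four_cycle {V : Type*} {D : OrientedGraph V} (h : D.IsAcyclic) {a b c d : V}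
    (h1 : D.arc a b) (h2 : D.arc b c) (h3 : D.arc c d) (h4 : D.arc d a) : False :=
  h a ((((Relation.TransGen.single h1).tail h2).tail h3).tail h4)

/-- The combinatorial core: three blocks of the same type force a constant discrepancy. -/
lemma core {n k j : ℕ} {ι : Type*} (x : Fin n → Fin k → ZMod 2) (X : Fin j → Set (Fin n))
    (hX : (vecTour x).IsDecycling X) (p : Fin 3 → ι → Fin n)
    (hp : ∀ s t i i', s < t → p s i < p t i')
    (w : ι → Fin k → ZMod 2) (hw : ∀ s i, x (p s i) = w i)
    (f : ι → Fin j → ZMod 2) (hf : ∀ s i, indVec X (p s i) = f i) :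
    ∃ δ : ZMod 2, ∀ i i', ∑ l, f i l * f i' l = ∑ l, w i l * w i' l + δ := by
  have hΔ : ∀ i i', ∃ δ : ZMod 2, ∑ l, f i l * f i' l = ∑ l, w i l * w i' l + δ :=
    fun i i' => ⟨∑ l, f i l * f i' l - ∑ l, w i l * w i' l, by ring⟩
  choose Δ hΔ using hΔ
  have hsymm : ∀ i i', Δ i i' = Δ i' i := by
    intro i i'
    have h1 := hΔ i i'
    have h2 := hΔ i' i
    simp only [mul_comm (f i' _), mul_comm (w i' _)] at h2
    rw [h1] at h2
    exact add_left_cancel h2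
  have fwd : ∀ s t i i', s < t → Δ i i' = 0 → ((vecTour x).invert X).arc (p s i) (p t i') := by
    intro s t i i' hst h
    apply invert_arc_fwd x X (hp s t i i' hst)
    rw [hf, hf, hw, hw, hΔ, h, add_zero]
  have bwd : ∀ s t i i', s < t → Δ i i' = 1 → ((vecTour x).invert X).arc (p t i') (p s i) := by
    intro s t i i' hst h
    apply invert_arc_bwd x X (hp s t i i' hst)
    rw [hf, hf, hw, hw, hΔ, h]
  have h01 : (0 : Fin 3) < 1 := by decide
  have h12 : (1 : Fin 3) < 2 := by decide
  have mixed : ∀ i i', Δ i i = 0 → Δ i' i' = 1 → False := by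
    intro i i' h0 h1
    rcases zmod2_cases (Δ i i') with h | h
    · have h' := (hsymm i' i).trans h
      exact no_four_cycle hX (fwd 1 2 i i' h12 h) (bwd 1 2 i' i' h12 h1) (bwd 0 1 i' i' h01 h1)
        (fwd 0 1 i' i h01 h')
    · have h' := (hsymm i' i).trans h
      exact no_four_cycle hX (fwd 0 1 i i h01 h0) (fwd 1 2 i i h12 h0) (bwd 1 2 i' i h12 h')
        (bwd 0 1 i i' h01 h)
  have same : ∀ i i', Δ i i = Δ i' i' → Δ i i' = Δ i i := by
    intro i i' hd
    rcases zmod2_cases (Δ i i) with h0 | h0 <;> rcases zmod2_cases (Δ i i') with h | h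
    · rw [h, h0]
    · exact (no_four_cycle hX (fwd 0 1 i i h01 h0) (bwd 0 1 i' i h01 ((hsymm i' i).trans h))
        (fwd 0 1 i' i' h01 (hd ▸ h0)) (bwd 0 1 i i' h01 h)).elim
    · exact (no_four_cycle hX (fwd 0 1 i i' h01 h) (bwd 0 1 i' i' h01 (hd ▸ h0))
        (fwd 0 1 i' i h01 ((hsymm i' i).trans h)) (bwd 0 1 i i h01 h0)).elim
    · rw [h, h0]
  have diag : ∀ i i', Δ i i = Δ i' i' := by
    intro i i'
    rcases zmod2_cases (Δ i i) with h0 | h0 <;> rcases zmod2_cases (Δ i' i') with h | h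
    · rw [h, h0]
    · exact (mixed i i' h0 h).elim
    · exact (mixed i' i h h0).elim
    · rw [h, h0]
  by_cases hne : Nonempty ι
  · obtain ⟨i0⟩ := hne
    refine ⟨Δ i0 i0, fun i i' => ?_⟩
    rw [hΔ, same i i' (diag i i'), diag i i0]
  · exact ⟨0, fun i => (hne ⟨i⟩).elim⟩

/-- Even weight vectors `e_a + e_last`. -/
def evVec (m : ℕ) (a i : Fin (m + 1)) : ZMod 2 :=
  (if i = a then 1 else 0) + (if i = Fin.last m then 1 else 0)

lemma evVec_sum (m : ℕ) (a : Fin (m + 1)) : ∑ i, evVec m a i = 0 := by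
  simp only [evVec, Finset.sum_add_distrib]
  simp
  decide

lemma evVec_last (m : ℕ) (i : Fin (m + 1)) : evVec m (Fin.last m) i = 0 := by
  unfold evVec
  split_ifs <;> decide

lemma evVec_dot (m : ℕ) (a b : Fin m) :
    ∑ i, evVec m a.castSucc i * evVec m b.castSucc i = (if a = b then 1 else 0) + 1 := by
  have ha : Fin.last m ≠ a.castSucc := (Fin.castSucc_lt_last a).ne'
  have hb : Fin.last m ≠ b.castSucc := (Fin.castSucc_lt_last b).ne'
  rw [Fin.sum_univ_castSucc]
  have h0 : ∀ i : Fin m, i.castSucc ≠ Fin.last m := fun i => (Fin.castSucc_lt_last i).ne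
  simp [evVec, ha, hb, h0, eq_comm]

/-- The tournament `T_{m+1}` with `N` blocks. -/
noncomputable def blockVec (N m : ℕ) (v : Fin (N * (m + 1))) : Fin (m + 1) → ZMod 2 :=
  evVec m (finProdFinEquiv.symm v).2

lemma block_lower (m j : ℕ) (hm : 0 < m) (he : Even m) (hj : j ≤ m) (N : ℕ)
    (hN : Fintype.card (Fin (m + 1) → Fin j → ZMod 2) * 2 < N)
    (X : Fin j → Set (Fin (N * (m + 1)))) : ¬ (vecTour (blockVec N m)).IsDecycling X := by
  classical
  intro hX
  let c : Fin N → (Fin (m + 1) → Fin j → ZMod 2) := fun s i => indVec X (finProdFinEquiv (s, i))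
  obtain ⟨f, hf⟩ := Fintype.exists_lt_card_fiber_of_mul_lt_card (f := c) (n := 2)
    (by rw [Fintype.card_fin]; exact hN)
  let e := Finset.orderEmbOfCardLe _ (Nat.succ_le_of_lt hf)
  have hmem : ∀ s, c (e s) = f := fun s => by
    have := Finset.orderEmbOfCardLe_mem _ (Nat.succ_le_of_lt hf) s
    simpa using this
  obtain ⟨δ, hδ⟩ := core (blockVec N m) X hX (fun s i => finProdFinEquiv (e s, i))
    (by
      intro s t i i' hst
      have h1 : e s < e t := e.strictMono hst
      have h2 : (e s).1 + 1 ≤ (e t).1 := h1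
      rw [Fin.lt_def]
      simp only [finProdFinEquiv_apply_val]
      have h3 := Nat.mul_le_mul_left (m + 1) h2
      have h4 := i.2
      rw [mul_add] at h3
      omega)
    (evVec m) (by intro s i; simp [blockVec]) f
    (by intro s i; exact congrFun (hmem s) i)
  refine no_gram m j hm he hj (fun a l => f a.castSucc l + f (Fin.last m) l) ?_
  intro a b
  simp only [add_mul, mul_add, Finset.sum_add_distrib, hδ, evVec_dot, evVec_last, mul_zero,
    zero_mul, Finset.sum_const_zero]
  have : ∀ q d : ZMod 2, q + 1 + d + (0 + d) + (0 + d + (0 + d)) = q + 1 := by decide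
  exact this _ _

lemma dijoin_acyclic {α β : Type*} {A : OrientedGraph α} {B : OrientedGraph β}
    (hA : A.IsAcyclic) (hB : B.IsAcyclic) : (A.dijoin B).IsAcyclic := by
  have h1 : ∀ p q, Relation.TransGen (A.dijoin B).arc p q →
      (∃ a b, p = Sum.inl a ∧ q = Sum.inl b ∧ Relation.TransGen A.arc a b) ∨
      (∃ a b, p = Sum.inr a ∧ q = Sum.inr b ∧ Relation.TransGen B.arc a b) ∨
      (∃ a b, p = Sum.inl a ∧ q = Sum.inr b) := by
    intro p q h
    induction h with
    | @single q h =>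
      rcases p with a | a <;> rcases q with b | b
      · exact Or.inl ⟨a, b, rfl, rfl, .single h⟩
      · exact Or.inr (Or.inr ⟨a, b, rfl, rfl⟩)
      · exact h.elim
      · exact Or.inr (Or.inl ⟨a, b, rfl, rfl, .single h⟩)
    | @tail q r _ h ih =>
      rcases ih with ⟨a, b, rfl, rfl, ih⟩ | ⟨a, b, rfl, rfl, ih⟩ | ⟨a, b, rfl, rfl⟩ <;>
        rcases r with c | c
      · exact Or.inl ⟨a, c, rfl, rfl, ih.tail h⟩
      · exact Or.inr (Or.inr ⟨a, c, rfl, rfl⟩)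
      · exact h.elim
      · exact Or.inr (Or.inl ⟨a, c, rfl, rfl, ih.tail h⟩)
      · exact h.elim
      · exact Or.inr (Or.inr ⟨a, c, rfl, rfl⟩)
  intro p hp
  rcases h1 p p hp with ⟨a, b, h, h', ht⟩ | ⟨a, b, h, h', ht⟩ | ⟨a, b, h, h'⟩
  · obtain rfl : a = b := Sum.inl.inj (h.symm.trans h')
    exact hA a ht
  · obtain rfl : a = b := Sum.inr.inj (h.symm.trans h')
    exact hB a ht
  · exact absurd (h.symm.trans h') (by simp)

/-- If `L` is decycled by an odd number `k` of sets, every vertex lying in an even number of them,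
then one inversion can be saved in every dijoin `L ⇒ R`. -/
lemma dijoin_save {α β : Type*} (L : OrientedGraph α) (R : OrientedGraph β) (k r : ℕ)
    (hk : Odd k) (X : Fin k → Set α) (hX : L.IsDecycling X)
    (hev : ∀ u, ∑ i, indVec X u i = 0) (Y : Fin (r + 1) → Set β) (hY : R.IsDecycling Y) :
    ∃ Z : Fin (k + r) → Set (α ⊕ β), (L.dijoin R).IsDecycling Z := by
  have hk1 : (k : ZMod 2) = 1 := (ZMod.natCast_eq_one_iff_odd).2 hk
  let Z : Fin (k + r) → Set (α ⊕ β) :=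
    Fin.append (fun i => Set.image Sum.inl (X i) ∪ Set.image Sum.inr (Y 0)) (fun i => Set.image Sum.inr (Y i.succ))
  have hz1 : ∀ i, Z (Fin.castAdd r i) = Set.image Sum.inl (X i) ∪ Set.image Sum.inr (Y 0) :=
    fun i => Fin.append_left _ _ i
  have hz2 : ∀ i, Z (Fin.natAdd k i) = Set.image Sum.inr (Y i.succ) :=
    fun i => Fin.append_right _ _ i
  have z1 : ∀ a i, indVec Z (Sum.inl a) (Fin.castAdd r i) = indVec X a i := by
    intro a i; apply indVec_congr; rw [hz1]; simp
  have z2 : ∀ a i, indVec Z (Sum.inl a) (Fin.natAdd k i) = 0 := by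
    intro a i; apply indVec_zero; rw [hz2]; simp
  have z3 : ∀ b i, indVec Z (Sum.inr b) (Fin.castAdd r i) = indVec Y b 0 := by
    intro a i; apply indVec_congr; rw [hz1]; simp
  have z4 : ∀ b i, indVec Z (Sum.inr b) (Fin.natAdd k i) = indVec Y b i.succ := by
    intro a i; apply indVec_congr; rw [hz2]; simp
  refine ⟨Z, ?_⟩
  have heq : ∀ p q, ((L.dijoin R).invert Z).arc p q → ((L.invert X).dijoin (R.invert Y)).arc p q := by
    intro p q h
    rcases p with a | a <;> rcases q with b | b <;>
      simp only [OrientedGraph.invert, OrientedGraph.dijoin, even_ncard_iff, Fin.sum_univ_add,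
        z1, z2, z3, z4, Fin.sum_univ_succ (n := r), mul_zero, zero_mul, Finset.sum_const_zero,
        add_zero, Finset.sum_const, Finset.card_univ, Fintype.card_fin, nsmul_eq_mul, hk1,
        one_mul, ← Finset.sum_mul, ← Finset.mul_sum, hev] at h ⊢
    · exact h
    · simp at h
    · exact h
  intro v hv
  exact dijoin_acyclic hX hY v (Relation.TransGen.mono heq _ _ hv)

lemma exists_T (k : ℕ) (hk : 3 ≤ k) (hodd : Odd k) :
    ∃ (n : ℕ) (T : OrientedGraph (Fin n)), T.IsTournament ∧ T.inv = k ∧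
      ∀ (β : Type) [Fintype β] (R : OrientedGraph β), 1 ≤ R.inv →
        (T.dijoin R).inv ≤ k + R.inv - 1 := by
  obtain ⟨m, rfl⟩ : ∃ m, k = m + 1 := ⟨k - 1, by omega⟩
  have he : Even m := by
    rcases Nat.even_or_odd m with h | h
    · exact h
    · exact absurd hodd (Nat.not_odd_iff_even.2 h.add_one)
  let N := Fintype.card (Fin (m + 1) → Fin m → ZMod 2) * 2 + 1
  have hN : ∀ j ≤ m, Fintype.card (Fin (m + 1) → Fin j → ZMod 2) * 2 < N := by
    intro j hj
    refine Nat.lt_succ_of_le (Nat.mul_le_mul_right 2 ?_)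
    simp only [Fintype.card_fun, Fintype.card_fin, ZMod.card]
    exact Nat.pow_le_pow_left (Nat.pow_le_pow_right (by norm_num) hj) _
  refine ⟨N * (m + 1), vecTour (blockVec N m), vecTour_isTournament _, ?_, ?_⟩
  · apply le_antisymm
    · exact Nat.sInf_le ⟨_, vecTour_decycling _⟩
    · refine le_csInf ⟨_, _, vecTour_decycling (blockVec N m)⟩ ?_
      rintro j ⟨X, hX⟩
      by_contra hlt
      have hj : j ≤ m := by omega
      exact block_lower m j (by omega) he hj N (hN j hj) X hX
  · intro β _ R hR
    have hmem : R.inv ∈ {k | ∃ X : Fin k → Set β, R.IsDecycling X} :=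
      Nat.sInf_mem (Nat.nonempty_of_pos_sInf hR)
    obtain ⟨r, hr⟩ : ∃ r, R.inv = r + 1 := ⟨R.inv - 1, by omega⟩
    rw [hr] at hmem ⊢
    obtain ⟨Y, hY⟩ := hmem
    refine Nat.sInf_le ?_
    refine dijoin_save _ R (m + 1) r hodd _ (vecTour_decycling (blockVec N m)) ?_ Y hY
    intro u
    simp only [indVec_vec]
    exact evVec_sum m _

/-- for every odd `k ≥ 3` there is a tournament `T_k` with `inv(T_k) = k`
such that `inv(T_k ⇒ R) ≤ k + inv(R) - 1` whenever `inv(R) ≥ 1`; in particular the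
identity `inv(L ⇒ R) = inv(L) + inv(R)` fails for some pair of oriented graphs. -/
theorem dijoin_conjecture_disproof (k : ℕ) (hk : 3 ≤ k) (hodd : Odd k) :
    (∃ (n : ℕ) (T : OrientedGraph (Fin n)), T.IsTournament ∧ T.inv = k ∧
      ∀ (β : Type) [Fintype β] (R : OrientedGraph β), 1 ≤ R.inv →
        (T.dijoin R).inv ≤ k + R.inv - 1) ∧
    ∃ (α β : Type) (_ : Fintype α) (_ : Fintype β)
      (L : OrientedGraph α) (R : OrientedGraph β),
        (L.dijoin R).inv ≠ L.inv + R.inv := by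
  obtain ⟨n, T, hT, hinv, h⟩ := exists_T k hk hodd
  refine ⟨⟨n, T, hT, hinv, h⟩, Fin n, Fin n, inferInstance, inferInstance, T, T, ?_⟩
  have := h (Fin n) T (by omega)
  omega
end

section
/- For every pair of positive integers k₁, k₂, there exists an integer f_T(k₁,k₂) such that every tournament T with inv(T) ≥ f_T(k₁,k₂) admits a partition (V₁, V₂) of its vertex set such that inv(T⟨V₁⟩) ≥ k₁ and inv(T⟨V₂⟩) ≥ k₂, where T⟨Vᵢ⟩ denotes the subtournament induced by Vᵢ. -/
section Helpers
open Classical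

namespace OrientedGraph

/-- Arc relation after inverting according to labels. -/
def flipArc {V : Type*} (T : OrientedGraph V) (L : V → Finset ℕ) (u v : V) : Prop :=
  (Even (L u ∩ L v).card ∧ T.arc u v) ∨ (¬ Even (L u ∩ L v).card ∧ T.arc v u)

/-- `T⟨S⟩` can be made acyclic with `k` inversions, encoded by labels and a rank function. -/
def DecOn {V : Type*} (T : OrientedGraph V) (S : Finset V) (k : ℕ) : Prop :=
  ∃ (L : V → Finset ℕ) (f : V → ℕ), (∀ v, L v ⊆ Finset.range k) ∧
    ∀ u ∈ S, ∀ v ∈ S, T.flipArc L u v → f u < f v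

lemma DecOn.mono {V : Type*} {T : OrientedGraph V} {S : Finset V} {j k : ℕ} (hjk : j ≤ k)
    (h : T.DecOn S j) : T.DecOn S k := by
  obtain ⟨L, f, h1, h2⟩ := h
  exact ⟨L, f, fun v => (h1 v).trans (Finset.range_mono hjk), h2⟩

lemma decOn_empty {V : Type*} (T : OrientedGraph V) (k : ℕ) : T.DecOn ∅ k :=
  ⟨fun _ => ∅, fun _ => 0, by simp, by simp⟩

lemma DecOn.insert {V : Type*} {T : OrientedGraph V} {S : Finset V} {k : ℕ} (v : V)
    (h : T.DecOn S k) : T.DecOn (Insert.insert v S) (k + 2) := by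
  obtain ⟨L, f, h1, h2⟩ := h
  have hk : ∀ u, k ∉ L u := fun u hu => by simpa using h1 u hu
  have hk1 : ∀ u, k + 1 ∉ L u := fun u hu => by simpa using h1 u hu
  let L' : V → Finset ℕ := fun u =>
    if u = v then {k} else if T.arc v u then L u ∪ {k, k + 1} else L u
  have hpar : ∀ u w, u ≠ v → w ≠ v →
      (Even (L' u ∩ L' w).card ↔ Even (L u ∩ L w).card) := by
    intro u w hu hw
    by_cases hu' : T.arc v u
    · by_cases hw' : T.arc v w
      · have : L' u ∩ L' w = (L u ∩ L w) ∪ {k, k + 1} := by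
          simp only [L', hu, hw, hu', hw', if_true, if_false]
          rw [← Finset.inter_union_distrib_right]
        rw [this, Finset.card_union_of_disjoint, Finset.card_pair (by omega)]
        · simp [Nat.even_add]
        · rw [Finset.disjoint_left]
          intro a ha hb
          simp only [Finset.mem_inter, Finset.mem_insert, Finset.mem_singleton] at ha hb
          rcases hb with rfl | rfl
          · exact hk _ ha.1
          · exact hk1 _ ha.1
      · have : L' u ∩ L' w = (L u ∩ L w) := by
          simp only [L', hu, hw, hu', hw', if_true, if_false]
          ext a
          simp only [Finset.mem_inter, Finset.mem_union, Finset.mem_insert, Finset.mem_singleton]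
          have := hk w
          have := hk1 w
          grind
        rw [this]
    · by_cases hw' : T.arc v w
      · have : L' u ∩ L' w = (L u ∩ L w) := by
          simp only [L', hu, hw, hu', hw', if_true, if_false]
          ext a
          simp only [Finset.mem_inter, Finset.mem_union, Finset.mem_insert, Finset.mem_singleton]
          have := hk u
          have := hk1 u
          grind
        rw [this]
      · simp [L', hu, hw, hu', hw']
  have hv1 : ∀ u, u ≠ v → T.arc v u → (L' v ∩ L' u).card = 1 := by
    intro u hu ha
    have : L' v ∩ L' u = {k} := by
      ext a
      simp only [L', hu, ha, if_true, if_false, Finset.mem_inter, Finset.mem_union,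
        Finset.mem_insert, Finset.mem_singleton]
      tauto
    rw [this, Finset.card_singleton]
  have hv2 : ∀ u, u ≠ v → ¬ T.arc v u → (L' v ∩ L' u).card = 0 := by
    intro u hu ha
    have := hk u
    simp [L', hu, ha, this]
  let M := S.sup f + 1
  refine ⟨L', fun u => if u = v then M else f u, ?_, ?_⟩
  · intro u a ha
    have := @h1 u a
    simp only [Finset.mem_range] at this ⊢
    simp only [L'] at ha
    split_ifs at ha
    · simp only [Finset.mem_singleton] at ha; omega
    · simp only [Finset.mem_union, Finset.mem_insert, Finset.mem_singleton] at ha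
      rcases ha with ha | ha | ha
      · have := this ha; omega
      · omega
      · omega
    · have := this ha; omega
  · intro u hu w hw ha
    by_cases huv : u = v
    · by_cases hwv : w = v
      · subst huv; subst hwv
        exact absurd ha (by simp [flipArc, T.irrefl'])
      · subst huv
        exfalso
        by_cases hvw : T.arc u w
        · have := hv1 w hwv hvw
          rcases ha with ⟨h, _⟩ | ⟨_, h⟩
          · rw [this] at h; exact absurd h (by decide)
          · exact T.asymm' _ _ hvw h
        · have := hv2 w hwv hvw
          rcases ha with ⟨_, h⟩ | ⟨h, _⟩
          · exact hvw h
          · rw [this] at h; exact h (by decide)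
    · have huS : u ∈ S := by simpa [huv] using hu
      by_cases hwv : w = v
      · simp only [huv, hwv, if_true, if_false, M]
        exact Nat.lt_succ_of_le (Finset.le_sup (f := f) huS)
      · have hwS : w ∈ S := by simpa [hwv] using hw
        simp only [huv, hwv, if_false]
        apply h2 u huS w hwS
        have := hpar u w huv hwv
        simpa only [flipArc, this] using ha

lemma DecOn.union {V : Type*} {T : OrientedGraph V} {S : Finset V} {k : ℕ} (F : Finset V)
    (h : T.DecOn S k) : T.DecOn (F ∪ S) (k + 2 * F.card) := by
  induction F using Finset.induction_on with
  | empty => simpa using h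
  | insert a F ha ih =>
    rw [Finset.insert_union, Finset.card_insert_of_notMem ha]
    exact ih.insert a

lemma exists_decOn {V : Type*} (T : OrientedGraph V) (S : Finset V) : ∃ k, T.DecOn S k :=
  ⟨_, by simpa using (T.decOn_empty 0).union S⟩

lemma ncard_label {V : Type*} {k : ℕ} (X : Fin k → Set V) (L : V → Finset ℕ)
    (hL : ∀ v, L v ⊆ Finset.range k) (g : V → V)
    (h : ∀ v (i : Fin k), v ∈ X i ↔ (i : ℕ) ∈ L (g v)) (u v : V) :
    {i : Fin k | u ∈ X i ∧ v ∈ X i}.ncard = (L (g u) ∩ L (g v)).card := by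
  rw [← Set.ncard_coe_finset, ← Set.ncard_image_of_injective _ Fin.val_injective]
  congr 1
  ext a
  simp only [Set.mem_image, Set.mem_setOf_eq, Finset.coe_inter, Set.mem_inter_iff,
    Finset.mem_coe, h]
  constructor
  · rintro ⟨i, hi, rfl⟩; exact hi
  · intro ha
    exact ⟨⟨a, by simpa using hL _ ha.1⟩, ha, rfl⟩

lemma DecOn.toDec {V : Type*} {T : OrientedGraph V} {S : Finset V} {k : ℕ} (h : T.DecOn S k)
    {W : Type*} (D : OrientedGraph W) (φ : W → V) (hφ : ∀ w, φ w ∈ S)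
    (hD : ∀ a b, D.arc a b → T.arc (φ a) (φ b)) :
    ∃ X : Fin k → Set W, D.IsDecycling X := by
  obtain ⟨L, f, h1, h2⟩ := h
  refine ⟨fun i => {w | (i : ℕ) ∈ L (φ w)}, ?_⟩
  have key : ∀ a b, (D.invert (fun i : Fin k => {w | (i : ℕ) ∈ L (φ w)})).arc a b →
      f (φ a) < f (φ b) := by
    intro a b hab
    apply h2 _ (hφ a) _ (hφ b)
    have hc := ncard_label (fun i : Fin k => {w | (i : ℕ) ∈ L (φ w)}) (fun w => L (φ w))
      (fun w => h1 _) id (fun v i => Iff.rfl) a b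
    simp only [invert, hc, id] at hab
    rcases hab with ⟨p, q⟩ | ⟨p, q⟩
    · exact Or.inl ⟨p, hD _ _ q⟩
    · exact Or.inr ⟨p, hD _ _ q⟩
  intro v hv
  have : ∀ a b, Relation.TransGen (D.invert (fun i : Fin k => {w | (i : ℕ) ∈ L (φ w)})).arc a b →
      f (φ a) < f (φ b) := by
    intro a b hab
    induction hab with
    | single h => exact key _ _ h
    | tail _ h ih => exact ih.trans (key _ _ h)
  exact lt_irrefl _ (this v v hv)

lemma decOn_of_induce {V : Type*} [Fintype V] {T : OrientedGraph V} {S : Finset V} {S' : Set V}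
    (hS : ∀ v, v ∈ S → v ∈ S')
    {k : ℕ} (X : Fin k → Set S') (h : (T.induce S').IsDecycling X) : T.DecOn S k := by
  let R := ((T.induce S').invert X).arc
  let L : V → Finset ℕ := fun v =>
    (Finset.range k).filter (fun i => ∃ (hi : i < k) (hv : v ∈ S'), (⟨v, hv⟩ : S') ∈ X ⟨i, hi⟩)
  let f : V → ℕ := fun v => if hv : v ∈ S' then
    {u : S' | Relation.TransGen R u ⟨v, hv⟩}.ncard else 0
  refine ⟨L, f, fun v => Finset.filter_subset _ _, ?_⟩
  intro u hu v hv ha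
  have hu' := hS u hu
  have hv' := hS v hv
  have hR : R ⟨u, hu'⟩ ⟨v, hv'⟩ := by
    have hc : {i : Fin k | (⟨u, hu'⟩ : S') ∈ X i ∧ (⟨v, hv'⟩ : S') ∈ X i}.ncard
        = (L u ∩ L v).card := by
      rw [← Set.ncard_coe_finset, ← Set.ncard_image_of_injective _ Fin.val_injective]
      congr 1
      ext a
      simp only [Set.mem_image, Set.mem_setOf_eq, Finset.coe_inter, Set.mem_inter_iff,
        Finset.mem_coe, L, Finset.mem_filter, Finset.mem_range]
      constructor
      · rintro ⟨i, hi, rfl⟩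
        exact ⟨⟨i.2, i.2, hu', hi.1⟩, ⟨i.2, i.2, hv', hi.2⟩⟩
      · rintro ⟨⟨_, hi, _, h1⟩, ⟨_, _, _, h2⟩⟩
        exact ⟨⟨a, hi⟩, ⟨h1, h2⟩, rfl⟩
    simp only [R, invert, hc]
    exact ha
  simp only [f, hu', hv', dif_pos]
  apply Set.ncard_lt_ncard _ (Set.toFinite _)
  rw [Set.ssubset_iff_of_subset]
  · exact ⟨⟨u, hu'⟩, Relation.TransGen.single hR, fun hh => h _ hh⟩
  · intro w hw
    exact Relation.TransGen.tail hw hR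

lemma le_inv_induce {V : Type*} [Fintype V] {T : OrientedGraph V} {S : Finset V} {S' : Set V}
    (hS : ∀ v, v ∈ S ↔ v ∈ S') {k : ℕ} (h : ¬ T.DecOn S (k - 1)) :
    k ≤ (T.induce S').inv := by
  apply le_csInf
  · obtain ⟨j, hj⟩ := T.exists_decOn S
    exact ⟨j, hj.toDec (T.induce S') Subtype.val (fun w => (hS _).2 w.2) (fun a b h => h)⟩
  · rintro j ⟨X, hX⟩
    by_contra hlt
    exact h ((decOn_of_induce (fun v hv => (hS v).1 hv) X hX).mono (by omega))

/-- A finite set of vertices can be listed by increasing rank. -/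
lemma exists_list {V : Type*} {T : OrientedGraph V} (hT : T.IsTournament) {S : Finset V}
    {L : V → Finset ℕ} {f : V → ℕ}
    (h2 : ∀ u ∈ S, ∀ v ∈ S, T.flipArc L u v → f u < f v) :
    ∃ l : List V, l.Nodup ∧ (∀ v, v ∈ l ↔ v ∈ S) ∧ l.length = S.card ∧
      l.Pairwise (T.flipArc L) := by
  have htot : ∀ u v, u ≠ v → T.flipArc L u v ∨ T.flipArc L v u := by
    intro u v huv
    have := hT u v huv
    simp only [flipArc, Finset.inter_comm (L v) (L u)]
    tauto
  let r : V → V → Prop := fun a b => f a ≤ f b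
  haveI : Std.Total r := ⟨fun a b => le_total (f a) (f b)⟩
  haveI : IsTrans V r := ⟨fun a b c h1 h2 => le_trans (α := ℕ) h1 h2⟩
  let l := S.toList.insertionSort r
  have hperm : l.Perm S.toList := List.perm_insertionSort r _
  have hnd : l.Nodup := hperm.nodup_iff.2 S.nodup_toList
  have hmem : ∀ v, v ∈ l ↔ v ∈ S := fun v => by rw [hperm.mem_iff, Finset.mem_toList]
  refine ⟨l, hnd, hmem, by rw [hperm.length_eq, Finset.length_toList], ?_⟩
  have hs : l.Pairwise r := List.pairwise_insertionSort r _
  have := hs.and hnd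
  refine List.Pairwise.imp_of_mem ?_ this
  rintro a b ha hb ⟨h, hne⟩
  rcases htot a b hne with h' | h'
  · exact h'
  · exact absurd (h2 _ ((hmem _).1 hb) _ ((hmem _).1 ha) h') (not_lt.2 h)

lemma flip_transfer {V W : Type*} {T : OrientedGraph V} {D : OrientedGraph W}
    {L : V → Finset ℕ} {M : W → Finset ℕ} {a b : V} {c d : W}
    (h1 : T.flipArc L a b) (h2 : D.flipArc M c d) (hac : L a = M c) (hbd : L b = M d) :
    (T.arc a b → D.arc c d) ∧ (T.arc b a → D.arc d c) := by
  simp only [flipArc, hac, hbd] at h1 h2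
  have := T.asymm' a b
  tauto

lemma transfer {V W : Type*} {T : OrientedGraph V} {D : OrientedGraph W}
    {L : V → Finset ℕ} {M : W → Finset ℕ} {l : List V} {l' : List W}
    (h1 : l.Pairwise (T.flipArc L)) (h2 : l'.Pairwise (D.flipArc M))
    (hmap : l.map L = l'.map M) {S : Finset V} (hS : ∀ v ∈ S, v ∈ l) {k : ℕ}
    (h : D.DecOn l'.toFinset k) : T.DecOn S k := by
  have hlen : l.length = l'.length := by simpa using congrArg List.length hmap
  rcases S.eq_empty_or_nonempty with rfl | ⟨v₀, hv₀⟩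
  · exact decOn_empty _ _
  have hne : 0 < l'.length := hlen ▸ List.length_pos_of_mem (hS _ hv₀)
  have hex : ∀ v : V, ∃ w : W, v ∈ S → ∃ (i : ℕ) (hi : i < l.length) (hi' : i < l'.length),
      l[i] = v ∧ l'[i] = w := by
    intro v
    by_cases hv : v ∈ S
    · obtain ⟨i, hi, hiv⟩ := List.getElem_of_mem (hS v hv)
      exact ⟨l'[i]'(hlen ▸ hi), fun _ => ⟨i, hi, hlen ▸ hi, hiv, rfl⟩⟩
    · exact ⟨l'[0], fun h => absurd h hv⟩
  choose φ hφ using hex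
  have hlab : ∀ (i : ℕ) (hi : i < l.length) (hi' : i < l'.length), L l[i] = M l'[i] := by
    intro i hi hi'
    have : (l.map L)[i]'(by simpa using hi) = (l'.map M)[i]'(by simpa using hi') := by
      simp only [hmap]
    simpa using this
  have harc : ∀ u ∈ S, ∀ v ∈ S, T.arc u v → D.arc (φ u) (φ v) := by
    intro u hu v hv ha
    obtain ⟨i, hi, hi', rfl, hw⟩ := hφ u hu
    obtain ⟨j, hj, hj', rfl, hx⟩ := hφ v hv
    rw [← hw, ← hx]
    rcases lt_trichotomy i j with hij | hij | hij
    · exact (flip_transfer (List.pairwise_iff_getElem.1 h1 i j hi hj hij)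
        (List.pairwise_iff_getElem.1 h2 i j hi' hj' hij) (hlab _ _ _) (hlab _ _ _)).1 ha
    · subst hij; exact absurd ha (T.irrefl' _)
    · exact (flip_transfer (List.pairwise_iff_getElem.1 h1 j i hj hi hij)
        (List.pairwise_iff_getElem.1 h2 j i hj' hi' hij) (hlab _ _ _) (hlab _ _ _)).2 ha
  have hφS : ∀ u ∈ S, φ u ∈ l'.toFinset := by
    intro u hu
    obtain ⟨i, hi, hi', _, hw⟩ := hφ u hu
    rw [← hw]
    simp
  obtain ⟨N, f, hN, hf⟩ := h
  refine ⟨fun v => N (φ v), fun v => f (φ v), fun v => hN _, ?_⟩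
  intro u hu v hv ha
  apply hf _ (hφS u hu) _ (hφS v hv)
  rcases ha with ⟨p, q⟩ | ⟨p, q⟩
  · exact Or.inl ⟨p, harc _ hu _ hv q⟩
  · exact Or.inr ⟨p, harc _ hv _ hu q⟩

lemma bounded_aux (K m : ℕ) : ∃ B : ℕ, ∀ (V : Type) (T : OrientedGraph V), T.IsTournament →
    ∀ S : Finset V, T.DecOn S m → ¬ T.DecOn S K → ∃ S' ⊆ S, S'.card ≤ B ∧ ¬ T.DecOn S' K := by
  by_contra hcon
  push Not at hcon
  choose V T hT S hm hK hS' using hcon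
  choose L f hL hf using hm
  have hlist := fun B => exists_list (hT B) (hf B)
  choose l hnd hmem hlen hpw using hlist
  let s : Set (Finset ℕ) := {x | x ⊆ Finset.range m}
  have hsfin : s.Finite := by
    have : s = ((Finset.range m).powerset : Set (Finset ℕ)) := by
      ext x; simp only [s, Finset.mem_coe, Finset.mem_powerset]; rfl
    rw [this]; exact Finset.finite_toSet _
  have hp : s.PartiallyWellOrderedOn (· = ·) := hsfin.partiallyWellOrderedOn
  have hh := Set.PartiallyWellOrderedOn.partiallyWellOrderedOn_sublistForall₂ (· = ·) hp
  haveI : IsPreorder (List (Finset ℕ)) (List.SublistForall₂ (· = ·)) :=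
    { refl := fun a => List.sublistForall₂_iff.2 ⟨a, List.forall₂_refl a, List.Sublist.refl a⟩
      trans := by
        intro a b c h1 h2
        obtain ⟨x, hx, hx'⟩ := List.sublistForall₂_iff.1 h1
        obtain ⟨y, hy, hy'⟩ := List.sublistForall₂_iff.1 h2
        rw [List.forall₂_eq_eq_eq] at hx hy
        subst hx; subst hy
        exact List.sublistForall₂_iff.2 ⟨a, List.forall₂_refl a, hx'.trans hy'⟩ }
  obtain ⟨g, hg⟩ := hh.exists_monotone_subseq (f := fun B => (l B).map (L B)) (by
    intro B x hx
    obtain ⟨v, _, rfl⟩ := List.mem_map.1 hx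
    exact hL B v)
  let a := g 0
  let N := (S a).card
  let b := g N
  have hb : (S a).card ≤ b := g.strictMono.le_apply
  have hsub : List.Sublist ((l a).map (L a)) ((l b).map (L b)) := by
    have := hg 0 N (Nat.zero_le _)
    rw [List.sublistForall₂_iff] at this
    obtain ⟨l1, h1, h2⟩ := this
    rw [List.forall₂_eq_eq_eq] at h1
    rw [← h1] at h2
    exact h2
  obtain ⟨l', hl', heq⟩ := List.sublist_map_iff.1 hsub
  have hlen' : l'.length = (S a).card := by
    rw [← hlen a]
    simpa using (congrArg List.length heq).symm
  have hdec : (T b).DecOn l'.toFinset K := by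
    apply hS' b
    · intro v hv
      exact (hmem b v).1 (hl'.subset (List.mem_toFinset.1 hv))
    · exact (List.toFinset_card_le l').trans (hlen' ▸ hb)
  exact hK a (transfer (hpw a) ((hpw b).sublist hl') heq (fun v hv => (hmem a v).2 hv) hdec)

lemma bounded (K : ℕ) : ∃ B : ℕ, ∀ (V : Type) (T : OrientedGraph V), T.IsTournament →
    ∀ S : Finset V, ¬ T.DecOn S K → ∃ S' ⊆ S, S'.card ≤ B ∧ ¬ T.DecOn S' K := by
  obtain ⟨B, hB⟩ := bounded_aux K (K + 2)
  refine ⟨B, fun V T hT S => ?_⟩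
  induction S using Finset.strongInduction with
  | H S ih =>
    intro hS
    by_cases h : ∃ S₁ ⊂ S, ¬ T.DecOn S₁ K
    · obtain ⟨S₁, h1, h2⟩ := h
      obtain ⟨S', h3, h4⟩ := ih S₁ h1 h2
      exact ⟨S', h3.trans h1.subset, h4⟩
    · push Not at h
      rcases S.eq_empty_or_nonempty with rfl | ⟨v, hv⟩
      · exact absurd (decOn_empty _ _) hS
      · have := (h _ (Finset.erase_ssubset hv)).insert v
        rw [Finset.insert_erase hv] at this
        exact hB V T hT S this hS

end OrientedGraph

end Helpers

/-- for all positive integers `k₁, k₂` there is `f_T(k₁,k₂)` such that every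
tournament with inversion number at least `f_T(k₁,k₂)` admits a vertex partition
`(V₁, V₂)` with `inv(T⟨V₁⟩) ≥ k₁` and `inv(T⟨V₂⟩) ≥ k₂`. -/
theorem tournament_splitting (k₁ k₂ : ℕ) (h₁ : 1 ≤ k₁) (h₂ : 1 ≤ k₂) :
    ∃ f : ℕ, ∀ (V : Type) [Fintype V] (T : OrientedGraph V), T.IsTournament →
      f ≤ T.inv → ∃ S : Set V, k₁ ≤ (T.induce S).inv ∧ k₂ ≤ (T.induce Sᶜ).inv := by
  classical
  obtain ⟨B, hB⟩ := OrientedGraph.bounded (k₁ - 1)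
  refine ⟨k₁ + k₂ + 2 * B, fun V _ T hT hf => ?_⟩
  have hno : ∀ j, j < k₁ + k₂ + 2 * B → ¬ T.DecOn Finset.univ j := by
    intro j hj hd
    have hle : T.inv ≤ j := Nat.sInf_le (hd.toDec T id (by simp) (fun a b h => h))
    omega
  obtain ⟨S, -, hcard, hS⟩ := hB V T hT Finset.univ (hno _ (by omega))
  refine ⟨(S : Set V), OrientedGraph.le_inv_induce (S := S) (by simp) hS,
    OrientedGraph.le_inv_induce (S := Sᶜ) (by simp) ?_⟩
  intro hd
  have := hd.union S
  rw [Finset.union_compl] at this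
  exact hno _ (by omega) this
end

section
/- Every oriented graph D that is not acyclic contains a directed cycle C such that inv(D − V(C)) ≥ inv(D) − 10, where D − V(C) denotes the subdigraph obtained by deleting the vertices of C. -/
namespace OrientedGraph

/-- Arcs of the inverted graph with both ends in `S`. -/
def resArc {V : Type} (D : OrientedGraph V) {k : ℕ} (X : Fin k → Set V) (S : Set V) (u v : V) :
    Prop := u ∈ S ∧ v ∈ S ∧ (D.invert X).arc u v

/-- `D[S]` can be decycled with `k` sets. -/
def Dec {V : Type} (D : OrientedGraph V) (S : Set V) (k : ℕ) : Prop :=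
  ∃ X : Fin k → Set V, ∀ v, ¬ Relation.TransGen (D.resArc X S) v v

/-- An independent set in which no vertex has both an in- and an out-neighbour. -/
def Good {V : Type} (D : OrientedGraph V) (Z : Set V) : Prop :=
  (∀ a ∈ Z, ∀ b ∈ Z, ¬ D.arc a b) ∧ ∀ a ∈ Z, ∀ b ∈ Z, ∀ v, D.arc a v → ¬ D.arc v b

/-- Number of sets of the family containing both vertices. -/
noncomputable def cnt {V : Type} {k : ℕ} (X : Fin k → Set V) (u v : V) : ℕ :=
  {i : Fin k | u ∈ X i ∧ v ∈ X i}.ncard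

open Classical in
theorem cnt_cons {V : Type} {k : ℕ} (X : Fin k → Set V) (A : Set V) (u v : V) :
    cnt (Fin.cons A X : Fin (k+1) → Set V) u v
      = (if u ∈ A ∧ v ∈ A then 1 else 0) + cnt X u v := by
  unfold cnt
  rw [Set.ncard_eq_toFinset_card', Set.ncard_eq_toFinset_card']
  simp only [Set.toFinset_ofPred]
  rw [Fin.card_filter_univ_succ]
  simp only [Fin.cons_zero, Fin.cons_succ, Function.comp_def]
  split_ifs <;> omega

theorem dec_step {V : Type} (D : OrientedGraph V) (S T Z : Set V) (k : ℕ) (hZ : D.Good Z)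
    (hT : ∀ v, v ∈ S → v ∉ Z → v ∈ T) (h : D.Dec T k) : D.Dec S (k + 2) := by
  classical
  obtain ⟨X, hX⟩ := h
  let Y : Set V := {v | ∃ z ∈ Z, D.arc v z}
  let X0 : Fin k → Set V := fun i => X i ∩ Zᶜ
  let X' : Fin (k+2) → Set V := Fin.cons (Y ∪ Z) (Fin.cons Y X0 : Fin (k+1) → Set V)
  have hYZ : ∀ v ∈ Y, v ∉ Z := by
    rintro v ⟨z, hz, hv⟩ hvZ
    exact hZ.1 v hvZ z hz hv
  have hc : ∀ u v, cnt X' u v = (if u ∈ Y ∪ Z ∧ v ∈ Y ∪ Z then 1 else 0)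
      + ((if u ∈ Y ∧ v ∈ Y then 1 else 0) + cnt X0 u v) := by
    intro u v
    rw [cnt_cons, cnt_cons]
    congr
  have hc1 : ∀ u v, u ∉ Z → v ∉ Z → (Even (cnt X' u v) ↔ Even (cnt X u v)) := by
    intro u v hu hv
    have : cnt X0 u v = cnt X u v := by
      unfold cnt; congr 1; ext i; simp [X0, hu, hv]
    rw [hc, this]
    by_cases h1 : u ∈ Y <;> by_cases h2 : v ∈ Y <;>
      simp [h1, h2, hu, hv, ← add_assoc, Nat.even_add]
  have hc2 : ∀ u v, v ∈ Z → u ∉ Z → (Even (cnt X' u v) ↔ u ∉ Y) := by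
    intro u v hv hu
    have : cnt X0 u v = 0 := by
      unfold cnt; simp [X0, hv]
    have hvY : v ∉ Y := fun h => hYZ v h hv
    rw [hc, this]
    by_cases h1 : u ∈ Y <;> simp [h1, hu, hv, hvY]
  have hno : ∀ u v, (D.invert X').arc u v → v ∉ Z := by
    intro u v huv hv
    have huv' : (Even (cnt X' u v) ∧ D.arc u v) ∨ (¬ Even (cnt X' u v) ∧ D.arc v u) := huv
    by_cases hu : u ∈ Z
    · rcases huv' with ⟨_, h⟩ | ⟨_, h⟩
      · exact hZ.1 _ hu _ hv h
      · exact hZ.1 _ hv _ hu h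
    · rw [hc2 u v hv hu] at huv'
      rcases huv' with ⟨h1, h⟩ | ⟨h1, h⟩
      · exact h1 ⟨v, hv, h⟩
      · obtain ⟨z, hz, hz'⟩ := not_not.1 h1
        exact hZ.2 v hv z hz u h hz'
  have hstep : ∀ u v, u ∉ Z → D.resArc X' S u v → D.resArc X T u v := by
    rintro u v hu ⟨h1, h2, h3⟩
    have hv := hno u v h3
    refine ⟨hT u h1 hu, hT v h2 hv, ?_⟩
    have h3' : (Even (cnt X' u v) ∧ D.arc u v) ∨ (¬ Even (cnt X' u v) ∧ D.arc v u) := h3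
    rw [hc1 u v hu hv] at h3'
    exact h3'
  have htr : ∀ u v, u ∉ Z → Relation.TransGen (D.resArc X' S) u v →
      v ∉ Z ∧ Relation.TransGen (D.resArc X T) u v := by
    intro u v hu huv
    induction huv with
    | single h => exact ⟨hno _ _ h.2.2, .single (hstep _ _ hu h)⟩
    | tail _ h ih => exact ⟨hno _ _ h.2.2, ih.2.tail (hstep _ _ ih.1 h)⟩
  refine ⟨X', fun v hv => ?_⟩
  have hvZ : v ∉ Z := by
    obtain ⟨b, _, hb⟩ := Relation.TransGen.tail'_iff.1 hv
    exact hno _ _ hb.2.2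
  exact hX v (htr v v hvZ hv).2

theorem dec_exists {V : Type} [Finite V] (D : OrientedGraph V) (S : Set V) : ∃ k, D.Dec S k := by
  classical
  induction S, S.toFinite using Set.Finite.induction_on with
  | empty =>
    refine ⟨0, fun _ => ∅, fun v hv => ?_⟩
    obtain ⟨b, _, hb⟩ := Relation.TransGen.tail'_iff.1 hv
    exact hb.1
  | @insert a s _ _ ih =>
    obtain ⟨k, hk⟩ := ih
    refine ⟨k + 2, dec_step D _ s {a} k ⟨?_, ?_⟩ ?_ hk⟩
    · rintro _ rfl _ rfl; exact D.irrefl' _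
    · rintro _ rfl _ rfl v; exact D.asymm' _ _
    · intro v hv hva
      exact hv.resolve_left hva

theorem dec_induce {V : Type} (D : OrientedGraph V) (S : Set V) (k : ℕ) :
    D.Dec S k ↔ ∃ X : Fin k → Set S, (D.induce S).IsDecycling X := by
  constructor
  · rintro ⟨X, hX⟩
    refine ⟨fun i => {x | x.1 ∈ X i}, fun v hv => hX v.1 ?_⟩
    exact Relation.TransGen.lift Subtype.val (fun a b hab => ⟨a.2, b.2, hab⟩) _ _ hv
  · rintro ⟨X, hX⟩
    refine ⟨fun i => Subtype.val '' X i, fun v hv => ?_⟩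
    have key : ∀ u w, Relation.TransGen (D.resArc (fun i => Subtype.val '' X i) S) u w →
        ∃ (hu : u ∈ S) (hw : w ∈ S),
          Relation.TransGen ((D.induce S).invert X).arc ⟨u, hu⟩ ⟨w, hw⟩ := by
      have st : ∀ u w, D.resArc (fun i => Subtype.val '' X i) S u w →
        ∃ (hu : u ∈ S) (hw : w ∈ S), ((D.induce S).invert X).arc ⟨u, hu⟩ ⟨w, hw⟩ := by
        rintro u w ⟨hu, hw, h⟩
        refine ⟨hu, hw, ?_⟩
        simpa [invert, induce, hu, hw] using h
      intro u w h
      induction h with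
      | single h =>
        obtain ⟨hu, hw, h⟩ := st _ _ h
        exact ⟨hu, hw, .single h⟩
      | tail _ h ih =>
        obtain ⟨hu, _, h1⟩ := ih
        obtain ⟨_, hw, h⟩ := st _ _ h
        exact ⟨hu, hw, h1.tail h⟩
    obtain ⟨hu, _, h⟩ := key v v hv
    exact hX _ h

theorem dec_univ {V : Type} (D : OrientedGraph V) (k : ℕ) (h : D.Dec Set.univ k) : D.inv ≤ k := by
  obtain ⟨X, hX⟩ := h
  refine Nat.sInf_le ⟨X, fun v hv => hX v ?_⟩
  exact Relation.TransGen.mono (fun a b hab => ⟨trivial, trivial, hab⟩) _ _ hv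

/-- Directed walks of a given length. -/
def Wk {V : Type} (D : OrientedGraph V) : ℕ → V → V → Prop
  | 0, u, v => u = v
  | n+1, u, v => ∃ w, Wk D n u w ∧ D.arc w v

theorem wk_add {V : Type} (D : OrientedGraph V) (m n : ℕ) (u v w : V) (h1 : D.Wk m u v)
    (h2 : D.Wk n v w) : D.Wk (m + n) u w := by
  induction n generalizing w with
  | zero => cases h2; exact h1
  | succ n ih =>
    obtain ⟨x, hx, hxw⟩ := h2
    exact ⟨x, ih x hx, hxw⟩

theorem wk_fun {V : Type} (D : OrientedGraph V) (n : ℕ) (u v : V) (h : D.Wk n u v) :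
    ∃ f : ℕ → V, f 0 = u ∧ f n = v ∧ ∀ i < n, D.arc (f i) (f (i+1)) := by
  classical
  induction n generalizing v with
  | zero => exact ⟨fun _ => u, rfl, h, by simp⟩
  | succ n ih =>
    obtain ⟨x, hx, hxv⟩ := h
    obtain ⟨f, h0, hn, hf⟩ := ih x hx
    refine ⟨fun i => if i ≤ n then f i else v, by simp [h0], by simp, fun i hi => ?_⟩
    rcases Nat.lt_succ_iff_lt_or_eq.1 hi with h | h
    · have : i + 1 ≤ n := h
      simp [this, h.le, hf i h]
    · subst h; simp [hn, hxv]

theorem wk_of_fun {V : Type} (D : OrientedGraph V) (n : ℕ) (f : ℕ → V)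
    (hf : ∀ i < n, D.arc (f i) (f (i+1))) (i d : ℕ) (h : i + d ≤ n) :
    D.Wk d (f i) (f (i + d)) := by
  induction d with
  | zero => rfl
  | succ d ih => exact ⟨f (i + d), ih (by omega), hf (i+d) (by omega)⟩

theorem wk_of_trans {V : Type} (D : OrientedGraph V) (u v : V)
    (h : Relation.TransGen D.arc u v) : ∃ n, 0 < n ∧ D.Wk n u v := by
  induction h with
  | single h => exact ⟨1, one_pos, _, rfl, h⟩
  | tail _ h ih =>
    obtain ⟨n, _, hw⟩ := ih
    exact ⟨n+1, by omega, _, hw, h⟩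

/-- The colouring of the positions on the cycle. -/
def col (l i : ℕ) : ℕ := if i < 3 * (l / 3) then i % 3 else 3 + (i - 3 * (l / 3))

theorem col_lt (l i : ℕ) (h : i < l) : col l i < 5 := by
  unfold col; split_ifs <;> omega

theorem col_eq (l i j : ℕ) (hij : i < j) (h : col l i = col l j) :
    i + 3 ≤ j ∧ (j < l → j + 3 ≤ l + i) := by
  unfold col at h; split_ifs at h <;> omega

end OrientedGraph

open OrientedGraph in
/-- every non-acyclic oriented graph `D` contains a directed cycle `C`
(given by an injective map `c : ZMod m → V`, `m ≥ 1`, with consecutive arcs) such that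
`inv(D - V(C)) ≥ inv(D) - 10`. -/
theorem exists_cycle_deletion (V : Type) [Fintype V] (D : OrientedGraph V)
    (hD : ¬ D.IsAcyclic) :
    ∃ (m : ℕ) (c : ZMod m → V), 0 < m ∧ Function.Injective c ∧
      (∀ i : ZMod m, D.arc (c i) (c (i + 1))) ∧
      D.inv ≤ (D.induce (Set.range c)ᶜ).inv + 10 := by
  classical
  have hex : ∃ n, 0 < n ∧ ∃ v, D.Wk n v v := by
    unfold IsAcyclic at hD
    push Not at hD
    obtain ⟨v, hv⟩ := hD
    obtain ⟨n, hn, h⟩ := wk_of_trans D v v hv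
    exact ⟨n, hn, v, h⟩
  obtain ⟨l, ⟨hl, v0, hw⟩, hmin0⟩ : ∃ l, (0 < l ∧ ∃ v, D.Wk l v v) ∧
      ∀ n, (0 < n ∧ ∃ v, D.Wk n v v) → l ≤ n :=
    ⟨Nat.find hex, Nat.find_spec hex, fun n hn => Nat.find_min' hex hn⟩
  have hmin : ∀ n v, 0 < n → D.Wk n v v → l ≤ n := fun n v h1 h2 => hmin0 n ⟨h1, v, h2⟩
  obtain ⟨f, f0, fl, hf⟩ := wk_fun D l v0 v0 hw
  -- walk from position `j` to position `i`
  have fwd : ∀ i j, i ≤ j → j ≤ l → D.Wk (j - i) (f i) (f j) := by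
    intro i j hij hj
    have := wk_of_fun D l f hf i (j - i) (by omega)
    rwa [Nat.add_sub_cancel' hij] at this
  have bwd : ∀ i j, i ≤ j → j ≤ l → D.Wk (l - j + i) (f j) (f i) := by
    intro i j hij hj
    refine wk_add D _ _ _ (f l) _ (fwd j l hj le_rfl) ?_
    have := fwd 0 i (by omega) (by omega)
    rw [f0, ← fl] at this
    simpa using this
  have finj : ∀ i j, i < j → j < l → f i ≠ f j := by
    intro i j hij hj h
    have := fwd i j hij.le hj.le
    rw [h] at this
    have := hmin _ _ (by omega) this
    omega
  haveI : NeZero l := ⟨hl.ne'⟩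
  let c : ZMod l → V := fun i => f i.val
  have hval : ∀ i : ZMod l, i.val < l := fun i => ZMod.val_lt i
  refine ⟨l, c, hl, ?_, ?_, ?_⟩
  · intro a b hab
    by_contra hne
    have hne' : a.val ≠ b.val := fun h => hne (ZMod.val_injective l h)
    rcases lt_or_gt_of_ne hne' with h | h
    · exact finj _ _ h (hval b) hab
    · exact finj _ _ h (hval a) hab.symm
  · intro i
    have h1 := hf i.val (hval i)
    have h2 : f (i + 1).val = f (i.val + 1) := by
      rw [ZMod.val_add, ZMod.val_one_eq_one_mod, Nat.add_mod_mod]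
      rcases Nat.lt_or_ge (i.val + 1) l with h | h
      · rw [Nat.mod_eq_of_lt h]
      · have : i.val + 1 = l := le_antisymm (hval i) h
        rw [this, Nat.mod_self, f0, fl]
    change D.arc (f i.val) (f (i + 1).val)
    rwa [h2]
  · have hrange : Set.range c = {v | ∃ i < l, f i = v} := by
      ext v
      constructor
      · rintro ⟨i, rfl⟩; exact ⟨i.val, hval i, rfl⟩
      · rintro ⟨i, hi, rfl⟩
        exact ⟨(i : ZMod l), by simp [c, ZMod.val_natCast, Nat.mod_eq_of_lt hi]⟩
    let Z : ℕ → Set V := fun q => {v | ∃ i < l, col l i = q ∧ f i = v}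
    have hgood : ∀ q, D.Good (Z q) := by
      intro q
      constructor
      · rintro _ ⟨i, hi, hiq, rfl⟩ _ ⟨j, hj, hjq, rfl⟩ h
        rcases lt_trichotomy i j with hij | rfl | hij
        · have h1 := col_eq l i j hij (hiq.trans hjq.symm)
          have h2 := hmin (l - j + i + 1) (f j) (by omega) ⟨_, bwd i j hij.le hj.le, h⟩
          omega
        · exact D.irrefl' _ h
        · have h1 := col_eq l j i hij (hjq.trans hiq.symm)
          have h2 := hmin (i - j + 1) (f j) (by omega) ⟨_, fwd j i hij.le hi.le, h⟩
          omega
      · rintro _ ⟨i, hi, hiq, rfl⟩ _ ⟨j, hj, hjq, rfl⟩ v h h'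
        rcases lt_trichotomy i j with hij | rfl | hij
        · have h1 := col_eq l i j hij (hiq.trans hjq.symm)
          have h2 := hmin (l - j + i + 1 + 1) (f j) (by omega)
            ⟨_, ⟨_, bwd i j hij.le hj.le, h⟩, h'⟩
          omega
        · exact D.asymm' _ _ h h'
        · have h1 := col_eq l j i hij (hjq.trans hiq.symm)
          have h2 := hmin (i - j + 1 + 1) (f j) (by omega)
            ⟨_, ⟨_, fwd j i hij.le hi.le, h⟩, h'⟩
          omega
    let T : ℕ → Set V := fun q => {v | ∀ i < l, q ≤ col l i → f i ≠ v}
    obtain ⟨k0, hk0⟩ := dec_exists D (Set.range c)ᶜ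
    have hk : ∃ X : Fin (D.induce (Set.range c)ᶜ).inv → Set ↑(Set.range c)ᶜ,
        (D.induce (Set.range c)ᶜ).IsDecycling X :=
      Nat.sInf_mem (s := {k | ∃ X : Fin k → Set ↑(Set.range c)ᶜ,
        (D.induce (Set.range c)ᶜ).IsDecycling X}) ⟨k0, (dec_induce D _ _).1 hk0⟩
    generalize (D.induce (Set.range c)ᶜ).inv = k at hk
    have hT : ∀ q, D.Dec (T q) (k + 2 * q) := by
      intro q
      induction q with
      | zero =>
        have h := (dec_induce D _ _).2 hk
        have e : (Set.range c)ᶜ = T 0 := by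
          rw [hrange]; ext v; simp [T]
        rw [e] at h
        exact h
      | succ q ih =>
        refine dec_step D _ (T q) (Z q) _ (hgood q) ?_ ih
        intro v hv hvZ i hi hqi hfi
        rcases Nat.eq_or_lt_of_le hqi with h | h
        · exact hvZ ⟨i, hi, h.symm, hfi⟩
        · exact hv i hi h hfi
    have h5 := hT 5
    have e5 : T 5 = Set.univ := by
      refine Set.eq_univ_of_forall fun v i hi h => ?_
      have := col_lt l i hi
      omega
    rw [e5] at h5
    exact dec_univ D _ h5
end
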